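/- (Existence of the critical front.) There exists a family of critical fronts on (−δ₀, δ₀) for some δ₀ ∈ (0, 1/√(12α)): that is, there exist η > 0, a continuous function μ : (−δ₀, δ₀) → ℝ, and for each δ ∈ (−δ₀, δ₀) an infinitely differentiable function q_δ : ℝ → ℝ and a constant C_δ > 0 such that (i) −δ²q_δ''''(x) + q_δ''(x) + c_*(δ)q_δ'(x) + f(q_δ(x)) = 0 for all x ∈ ℝ; (ii) q_δ(x) → 1 as x → −∞; (iii) |q_δ(x) − (μ(δ) + x)e^{−η_*(δ)x}| ≤ C_δ e^{−(η_*(δ)+η)x} for all x ≥ 0 (in particular q_δ(x) → 0 as x → ∞); and (iv) δ ↦ q_δ is continuous from (−δ₀, δ₀) into the bounded continuous functions on ℝ equipped with the supremum norm. -/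

import Mathlib

noncomputable def etaStar (α δ : ℝ) : ℝ :=
  if δ = 0 then Real.sqrt α
  else 1 / (|δ| * Real.sqrt 6) * Real.sqrt (1 - Real.sqrt (1 - 12 * δ ^ 2 * α))

noncomputable def cStar (α δ : ℝ) : ℝ :=
  2 * etaStar α δ - 4 * δ ^ 2 * etaStar α δ ^ 3

/-- `f` is a Fisher-KPP nonlinearity: smooth, `f(0) = f(1) = 0`, `f'(0) > 0`,
`f'(1) < 0`, and `f'' < 0` on `(0,1)`. -/
def KPP (f : ℝ → ℝ) : Prop :=
  ContDiff ℝ (⊤ : ℕ∞) f ∧ f 0 = 0 ∧ f 1 = 0 ∧ 0 < deriv f 0 ∧ deriv f 1 < 0 ∧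
    ∀ u ∈ Set.Ioo (0 : ℝ) 1, iteratedDeriv 2 f u < 0

/-- A family of critical fronts on `(-δ₀, δ₀)` for the extended Fisher-KPP
equation with nonlinearity `f` (with `α := f'(0)`): an exponent `η > 0`,
a continuous shift `μ`, and for each `δ` a smooth front `q δ` with constant
`C δ > 0` solving the traveling-wave ODE at speed `c_*(δ)`, converging to `1`
at `-∞`, with weak exponential decay `q δ x ≈ (μ δ + x) e^{-η_*(δ) x}` at
`+∞`, and depending continuously on `δ` in the supremum norm. -/
structure FrontFamily (f : ℝ → ℝ) (δ₀ : ℝ) where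
  η : ℝ
  μ : ℝ → ℝ
  q : ℝ → ℝ → ℝ
  C : ℝ → ℝ
  η_pos : 0 < η
  μ_cont : ContinuousOn μ (Set.Ioo (-δ₀) δ₀)
  q_smooth : ∀ δ ∈ Set.Ioo (-δ₀) δ₀, ContDiff ℝ (⊤ : ℕ∞) (q δ)
  C_pos : ∀ δ ∈ Set.Ioo (-δ₀) δ₀, 0 < C δ
  ode : ∀ δ ∈ Set.Ioo (-δ₀) δ₀, ∀ x : ℝ,
    -δ ^ 2 * iteratedDeriv 4 (q δ) x + iteratedDeriv 2 (q δ) x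
      + cStar (deriv f 0) δ * deriv (q δ) x + f (q δ x) = 0
  limit_left : ∀ δ ∈ Set.Ioo (-δ₀) δ₀, Filter.Tendsto (q δ) Filter.atBot (nhds 1)
  decay : ∀ δ ∈ Set.Ioo (-δ₀) δ₀, ∀ x : ℝ, 0 ≤ x →
    |q δ x - (μ δ + x) * Real.exp (-(etaStar (deriv f 0) δ * x))|
      ≤ C δ * Real.exp (-((etaStar (deriv f 0) δ + η) * x))
  q_cont : ∀ δ ∈ Set.Ioo (-δ₀) δ₀, ∀ ε > (0 : ℝ), ∃ ρ > (0 : ℝ),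
    ∀ δ' ∈ Set.Ioo (-δ₀) δ₀, |δ' - δ| < ρ → ∀ x : ℝ, |q δ' x - q δ x| ≤ ε

namespace CF

open Set Filter Topology MeasureTheory

/-- The resolvent `(1 + a ∂)⁻¹`. -/
noncomputable def Eop (a : ℝ) (h : ℝ → ℝ) (x : ℝ) : ℝ :=
  ∫ s in Ioi (0:ℝ), Real.exp (-s) * h (x - a * s)

/-- bounded continuous -/
def BC (h : ℝ → ℝ) : Prop := Continuous h ∧ ∃ M, ∀ x, |h x| ≤ M

lemma exp_int {k : ℝ} (hk : 0 < k) : IntegrableOn (fun s => Real.exp (-(k * s))) (Ioi (0:ℝ)) := by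
  have := exp_neg_integrableOn_Ioi 0 hk
  simpa [neg_mul] using this

lemma exp_int_val {k : ℝ} (hk : 0 < k) : ∫ s in Ioi (0:ℝ), Real.exp (-(k * s)) = 1 / k := by
  have := integral_exp_mul_Ioi (a := -k) (by linarith) 0
  simp only [neg_mul] at this
  rw [this]; simp; 

lemma Eop_int {h : ℝ → ℝ} (hh : BC h) (a x : ℝ) :
    IntegrableOn (fun s => Real.exp (-s) * h (x - a * s)) (Ioi (0:ℝ)) := by
  obtain ⟨hc, M, hM⟩ := hh
  have h1 : IntegrableOn (fun s => Real.exp (-s)) (Ioi (0:ℝ)) := by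
    simpa using exp_int (k := 1) one_pos
  refine Integrable.mono' (h1.mul_const M) ?_ ?_
  · exact (by fun_prop : Continuous _).aestronglyMeasurable
  · refine Eventually.of_forall fun s => ?_
    rw [norm_mul, Real.norm_eq_abs, Real.norm_eq_abs, abs_of_pos (Real.exp_pos _)]
    exact mul_le_mul_of_nonneg_left (hM _) (Real.exp_pos _).le

lemma Eop_le {h : ℝ → ℝ} (hh : BC h) {a k l A B : ℝ} (hk : 0 < 1 + a * k) (hl : 0 < 1 + a * l)
    (hle : ∀ x, h x ≤ A * Real.exp (k * x) + B * Real.exp (l * x)) (x : ℝ) :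
    Eop a h x ≤ A / (1 + a * k) * Real.exp (k * x) + B / (1 + a * l) * Real.exp (l * x) := by
  have e1 := (exp_int hk).mul_const (A * Real.exp (k * x))
  have e2 := (exp_int hl).mul_const (B * Real.exp (l * x))
  have key : Eop a h x ≤ ∫ s in Ioi (0:ℝ), (Real.exp (-((1 + a * k) * s)) * (A * Real.exp (k * x))
      + Real.exp (-((1 + a * l) * s)) * (B * Real.exp (l * x))) := by
    refine integral_mono (Eop_int hh a x) (e1.add e2) fun s => ?_
    have := mul_le_mul_of_nonneg_left (hle (x - a * s)) (Real.exp_pos (-s)).le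
    refine this.trans (le_of_eq ?_)
    have i1 : Real.exp (-((1 + a * k) * s)) * Real.exp (k * x)
        = Real.exp (-s) * Real.exp (k * (x - a * s)) := by
      rw [← Real.exp_add, ← Real.exp_add]; ring_nf
    have i2 : Real.exp (-((1 + a * l) * s)) * Real.exp (l * x)
        = Real.exp (-s) * Real.exp (l * (x - a * s)) := by
      rw [← Real.exp_add, ← Real.exp_add]; ring_nf
    linear_combination (-A) * i1 - B * i2
  refine key.trans (le_of_eq ?_)
  rw [integral_add e1 e2, integral_mul_const, integral_mul_const, exp_int_val hk, exp_int_val hl]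
  ring

lemma Eop_const (a c x : ℝ) : Eop a (fun _ => c) x = c := by
  unfold Eop
  rw [integral_mul_const]
  have := exp_int_val (k := 1) one_pos
  simp only [one_mul] at this
  rw [this]; ring

lemma Eop_sub {h g : ℝ → ℝ} (hh : BC h) (hg : BC g) (a x : ℝ) :
    Eop a (fun y => h y - g y) x = Eop a h x - Eop a g x := by
  unfold Eop
  rw [← integral_sub (Eop_int hh a x) (Eop_int hg a x)]
  congr 1; ext s; ring

lemma Eop_neg (h : ℝ → ℝ) (a x : ℝ) :
    Eop a (fun y => - h y) x = - Eop a h x := by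
  unfold Eop
  rw [← integral_neg]
  congr 1; ext s; ring

lemma Eop_le' {h : ℝ → ℝ} (hh : BC h) {B : ℝ} (hle : ∀ x, h x ≤ B) (a x : ℝ) :
    Eop a h x ≤ B := by
  have := Eop_le hh (a := a) (k := 0) (l := 0) (A := 0) (B := B) (by simp) (by simp)
    (by simpa using hle) x
  simpa using this

lemma BC.neg {h : ℝ → ℝ} (hh : BC h) : BC (fun x => - h x) :=
  ⟨hh.1.neg, hh.2.imp fun M hM x => by simpa using hM x⟩

lemma BC.sub {h g : ℝ → ℝ} (hh : BC h) (hg : BC g) : BC (fun x => h x - g x) := by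
  obtain ⟨hc, M, hM⟩ := hh
  obtain ⟨gc, K, hK⟩ := hg
  exact ⟨hc.sub gc, M + K, fun x => (abs_sub _ _).trans (add_le_add (hM x) (hK x))⟩

lemma BC.of_mem {h : ℝ → ℝ} {lo hi : ℝ} (hc : Continuous h) (hb : ∀ x, h x ∈ Icc lo hi) : BC h := by
  refine ⟨hc, max |lo| |hi|, fun x => abs_le_max_abs_abs (hb x).1 (hb x).2⟩

lemma Eop_ge' {h : ℝ → ℝ} (hh : BC h) {B : ℝ} (hle : ∀ x, B ≤ h x) (a x : ℝ) :
    B ≤ Eop a h x := by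
  have := Eop_le' hh.neg (B := -B) (fun x => by simpa using hle x) a x
  rw [Eop_neg] at this; linarith

lemma Eop_mono {h : ℝ → ℝ} (hh : BC h) (hm : Monotone h) (a : ℝ) : Monotone (Eop a h) := by
  intro x y hxy
  refine integral_mono (Eop_int hh a x) (Eop_int hh a y) fun s => ?_
  exact mul_le_mul_of_nonneg_left (hm (by linarith)) (Real.exp_pos _).le

lemma Eop_cont {D : Type*} [TopologicalSpace D] [FirstCountableTopology D] {H : D → ℝ → ℝ}
    {a : D → ℝ} (hH : Continuous (fun p : D × ℝ => H p.1 p.2)) (ha : Continuous a)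
    {M : ℝ} (hM : ∀ d x, |H d x| ≤ M) :
    Continuous (fun p : D × ℝ => Eop (a p.1) (H p.1) p.2) := by
  unfold Eop
  have h1 : IntegrableOn (fun s => Real.exp (-s)) (Ioi (0:ℝ)) := by
    simpa using exp_int (k := 1) one_pos
  refine continuous_of_dominated (bound := fun s => Real.exp (-s) * M) ?_ ?_ ?_ ?_
  · intro p
    have : Continuous (fun s : ℝ => H p.1 (p.2 - a p.1 * s)) :=
      hH.comp (by fun_prop : Continuous (fun s : ℝ => (p.1, p.2 - a p.1 * s)))
    exact (by fun_prop : Continuous (fun s : ℝ => Real.exp (-s) * H p.1 (p.2 - a p.1 * s))).aestronglyMeasurable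
  · intro p
    refine Eventually.of_forall fun s => ?_
    rw [norm_mul, Real.norm_eq_abs, Real.norm_eq_abs, abs_of_pos (Real.exp_pos _)]
    exact mul_le_mul_of_nonneg_left (hM _ _) (Real.exp_pos _).le
  · exact h1.mul_const M
  · refine Eventually.of_forall fun s => ?_
    have : Continuous (fun p : D × ℝ => H p.1 (p.2 - a p.1 * s)) :=
      hH.comp (by fun_prop : Continuous (fun p : D × ℝ => (p.1, p.2 - a p.1 * s)))
    fun_prop

lemma Eop_abs {h : ℝ → ℝ} {M : ℝ} (hc : Continuous h) (hM : ∀ x, |h x| ≤ M) (a x : ℝ) :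
    |Eop a h x| ≤ M := by
  have hh : BC h := ⟨hc, M, hM⟩
  exact abs_le.2 ⟨Eop_ge' hh (fun x => (abs_le.1 (hM x)).1) a x,
    Eop_le' hh (fun x => (abs_le.1 (hM x)).2) a x⟩

lemma Eop_bc {h : ℝ → ℝ} (hh : BC h) (a : ℝ) : BC (Eop a h) := by
  obtain ⟨hc, M, hM⟩ := hh
  refine ⟨?_, M, Eop_abs hc hM a⟩
  have := Eop_cont (D := Unit) (H := fun _ => h) (a := fun _ => a) (by fun_prop) (by fun_prop)
    (M := M) (fun _ => hM)
  exact this.comp (by fun_prop : Continuous (fun x : ℝ => ((), x)))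

lemma Eop_zero (h : ℝ → ℝ) : Eop 0 h = h := by
  ext x
  have := Eop_const 0 (h x) x
  simpa [Eop] using this

lemma Eop_hasDerivAt_pos {h : ℝ → ℝ} (hh : BC h) {a : ℝ} (ha : 0 < a) (x : ℝ) :
    HasDerivAt (Eop a h) ((h x - Eop a h x) / a) x := by
  obtain ⟨hc, M, hM⟩ := hh
  have hgc : Continuous (fun y => Real.exp (y / a) * h y) := by fun_prop
  have hint : ∀ x, IntegrableOn (fun y => Real.exp (y / a) * h y) (Iic x) := by
    intro x
    have h1 : IntegrableOn (fun y => Real.exp (y / a)) (Iic x) := by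
      have := integrableOn_exp_mul_Iic (a := 1 / a) (by positivity) x
      refine this.congr_fun (fun y _ => ?_) measurableSet_Iic
      simp only []; congr 1; ring
    refine Integrable.mono' (h1.mul_const M) hgc.aestronglyMeasurable ?_
    refine Eventually.of_forall fun s => ?_
    rw [norm_mul, Real.norm_eq_abs, Real.norm_eq_abs, abs_of_pos (Real.exp_pos _)]
    exact mul_le_mul_of_nonneg_left (hM _) (Real.exp_pos _).le
  have hform : ∀ x, Eop a h x = Real.exp (-(x / a)) / a * ∫ y in Iic x, Real.exp (y / a) * h y := by
    intro x
    have e1 : ∫ y in Iic x, Real.exp (y / a) * h y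
        = ∫ t in Ioi (0:ℝ), Real.exp ((x - t) / a) * h (x - t) := by
      have mp := Measure.measurePreserving_sub_left (volume : Measure ℝ) x
      have := mp.setIntegral_preimage_emb (Homeomorph.subLeft x).measurableEmbedding
        (fun y => Real.exp (y / a) * h y) (Iic x)
      rw [← this, ← integral_Ici_eq_integral_Ioi]
      congr 2; ext t; simp
    rw [e1]
    have e2 := integral_comp_mul_left_Ioi (fun t => Real.exp ((x - t) / a) * h (x - t)) 0 ha
    rw [mul_zero, smul_eq_mul] at e2
    rw [div_eq_mul_inv, mul_assoc, ← e2, ← integral_const_mul]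
    unfold Eop
    congr 1; ext s
    rw [← mul_assoc, ← Real.exp_add]
    congr 2; field_simp; ring
  have hd : HasDerivAt (fun x => ∫ y in Iic x, Real.exp (y / a) * h y) (Real.exp (x / a) * h x) x := by
    have e : (fun x => ∫ y in Iic x, Real.exp (y / a) * h y)
        = fun x => (∫ y in Iic 0, Real.exp (y / a) * h y) + ∫ y in (0:ℝ)..x, Real.exp (y / a) * h y := by
      ext x
      have := intervalIntegral.integral_Iic_sub_Iic (hint 0) (hint x)
      linarith
    rw [e]
    exact (hgc.integral_hasStrictDerivAt 0 x).hasDerivAt.const_add _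
  have hx : HasDerivAt (fun x => Real.exp (-(x / a)) / a) (Real.exp (-(x / a)) * (-(1 / a)) / a) x :=
    (((hasDerivAt_id x).div_const a).neg.exp).div_const a
  have := hx.mul hd
  rw [show Eop a h = _ from funext hform]
  refine this.congr_deriv ?_
  have e3 : Real.exp (-(x / a)) * Real.exp (x / a) = 1 := by rw [← Real.exp_add]; simp
  field_simp
  linear_combination (h x * a) * e3

lemma Eop_hasDerivAt {h : ℝ → ℝ} (hh : BC h) {a : ℝ} (ha : a ≠ 0) (x : ℝ) :
    HasDerivAt (Eop a h) ((h x - Eop a h x) / a) x := by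
  rcases lt_or_gt_of_ne ha with h1 | h1
  · have hh' : BC (fun y => h (-y)) := ⟨hh.1.comp continuous_neg, hh.2.imp fun M hM x => hM _⟩
    have e : ∀ x, Eop a h x = Eop (-a) (fun y => h (-y)) (-x) := by
      intro x; unfold Eop
      congr 1; ext s; congr 2; ring
    have := (Eop_hasDerivAt_pos hh' (a := -a) (by linarith) (-x)).comp x (hasDerivAt_neg x)
    rw [show Eop a h = _ from funext e]
    refine this.congr_deriv ?_
    rw [neg_neg]; field_simp
  · exact Eop_hasDerivAt_pos hh h1 x

lemma Eop_contDiff_succ {h : ℝ → ℝ} (hh : BC h) {a : ℝ} (ha : a ≠ 0) (n : ℕ)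
    (hn : ContDiff ℝ n h) : ContDiff ℝ (n + 1 : ℕ) (Eop a h) := by
  have hd : deriv (Eop a h) = fun x => (h x - Eop a h x) / a :=
    funext fun x => (Eop_hasDerivAt hh ha x).deriv
  have hdiff : Differentiable ℝ (Eop a h) := fun x => (Eop_hasDerivAt hh ha x).differentiableAt
  induction n with
  | zero =>
    rw [Nat.zero_add]
    refine contDiff_one_iff_deriv.2 ⟨hdiff, ?_⟩
    rw [hd]
    exact (hh.1.sub hdiff.continuous).div_const _
  | succ n ih =>
    have h1 := ih (hn.of_le (by exact_mod_cast Nat.le_succ n))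
    have := contDiff_succ_iff_deriv (𝕜 := ℝ) (n := ((n + 1 : ℕ) : WithTop ℕ∞)) (f := Eop a h)
    push_cast at this ⊢
    rw [this]
    refine ⟨hdiff, by simp, ?_⟩
    rw [hd]
    push_cast at hn h1
    exact (hn.sub h1).div_const _

lemma Eop_contDiff {h : ℝ → ℝ} (hh : BC h) (a : ℝ) (n : ℕ)
    (hn : ContDiff ℝ n h) : ContDiff ℝ n (Eop a h) := by
  by_cases ha : a = 0
  · subst ha; rwa [Eop_zero]
  · exact (Eop_contDiff_succ hh ha n hn).of_le (by exact_mod_cast Nat.le_succ n)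

/-- inversion -/
lemma Eop_inv {h : ℝ → ℝ} (hh : BC h) (a : ℝ) (x : ℝ) :
    h x = Eop a h x + a * deriv (Eop a h) x := by
  by_cases ha : a = 0
  · subst ha; simp [Eop_zero]
  · rw [(Eop_hasDerivAt hh ha x).deriv]; field_simp; ring

/-- Facts about the nonlinearity. -/
structure NL (f : ℝ → ℝ) (α β C : ℝ) : Prop where
  smooth : ContDiff ℝ (⊤ : ℕ∞) f
  hα : 0 < α
  hβ : 0 < β
  hC : 0 < C
  f0 : f 0 = 0
  f1 : f 1 = 0
  pos : ∀ u ∈ Ioo (0:ℝ) 1, 0 < f u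
  up : ∀ u ∈ Icc (0:ℝ) 1, ∀ w ∈ Icc (0:ℝ) 1, u ≤ w → f w - f u ≤ α * (w - u)
  low : ∀ u ∈ Icc (0:ℝ) 1, ∀ w ∈ Icc (0:ℝ) 1, u ≤ w → -β * (w - u) ≤ f w - f u
  quad0 : ∀ u ∈ Icc (0:ℝ) 1, α * u - f u ≤ C * u ^ 2
  quad1 : ∀ u ∈ Icc (0:ℝ) 1, β * u - f (1 - u) ≤ C * u ^ 2

lemma KPP.nl {f : ℝ → ℝ} (hf : KPP f) : ∃ C, NL f (deriv f 0) (-deriv f 1) C := by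
  obtain ⟨hs, h0, h1, ha, hb, hc⟩ := hf
  have hd : Differentiable ℝ f := hs.differentiable (by simp)
  have hs' : ContDiff ℝ 2 f := hs.of_le (WithTop.coe_le_coe.2 le_top)
  have hs1 : ContDiff ℝ 1 (deriv f) := by
    have := (contDiff_succ_iff_deriv (𝕜 := ℝ) (n := 1) (f := f)).1 (by simpa [one_add_one_eq_two] using hs')
    exact this.2.2
  have hd1 : Differentiable ℝ (deriv f) := hs1.differentiable (by simp)
  have e2 : ∀ u, iteratedDeriv 2 f u = deriv (deriv f) u := by
    intro u; rw [iteratedDeriv_succ, iteratedDeriv_one]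
  have hanti : AntitoneOn (deriv f) (Icc 0 1) := by
    refine antitoneOn_of_deriv_nonpos (convex_Icc 0 1) hd1.continuous.continuousOn
      hd1.differentiableOn ?_
    intro x hx
    rw [interior_Icc] at hx
    rw [← e2]; exact (hc x hx).le
  have hconc : StrictConcaveOn ℝ (Icc 0 1) f := by
    refine strictConcaveOn_of_deriv2_neg (convex_Icc 0 1) hd.continuous.continuousOn ?_
    intro x hx
    rw [interior_Icc] at hx
    have := hc x hx
    rwa [e2] at this
  have hc2 : Continuous (deriv (deriv f)) := hs1.continuous_deriv (le_refl _)
  obtain ⟨K, hK⟩ := isCompact_Icc.exists_bound_of_continuousOn (s := Icc (0:ℝ) 1) hc2.continuousOn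
  have hlip : ∀ u ∈ Icc (0:ℝ) 1, ∀ w ∈ Icc (0:ℝ) 1, |deriv f w - deriv f u| ≤ K * |w - u| := by
    intro u hu w hw
    exact (convex_Icc (0:ℝ) 1).norm_image_sub_le_of_norm_deriv_le
      (fun x _ => hd1 x) (fun x hx => hK x hx) hu hw
  have hK0 : 0 ≤ K := (norm_nonneg _).trans (hK 0 (by simp))
  -- Taylor
  have htay : ∀ u ∈ Icc (0:ℝ) 1, ∀ w ∈ Icc (0:ℝ) 1,
      |f w - f u - deriv f u * (w - u)| ≤ K * |w - u| ^ 2 := by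
    intro u hu w hw
    have hsub : uIcc u w ⊆ Icc 0 1 := by
      intro x hx
      exact ordConnected_Icc.uIcc_subset hu hw hx
    have := (convex_uIcc u w).norm_image_sub_le_of_norm_deriv_le
      (f := fun x => f x - deriv f u * x) (C := K * |w - u|) (x := u) (y := w)
      (fun x _ => by fun_prop) (fun x hx => ?_) left_mem_uIcc right_mem_uIcc
    · rw [Real.norm_eq_abs, Real.norm_eq_abs] at this
      calc _ = |f w - deriv f u * w - (f u - deriv f u * u)| := by congr 1; ring
        _ ≤ _ := this
        _ = _ := by ring
    · have e : deriv (fun x => f x - deriv f u * x) x = deriv f x - deriv f u := by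
        have := ((hd x).hasDerivAt.sub ((hasDerivAt_id x).const_mul (deriv f u))).deriv
        rw [show (fun x => f x - deriv f u * x) = f - fun y => deriv f u * id y from rfl, this, mul_one]
      rw [e, Real.norm_eq_abs]
      refine (hlip u hu x (hsub hx)).trans ?_
      refine mul_le_mul_of_nonneg_left ?_ hK0
      exact abs_sub_left_of_mem_uIcc hx
  have hder : ∀ u ∈ Icc (0:ℝ) 1, deriv f u ≤ deriv f 0 ∧ deriv f 1 ≤ deriv f u := by
    intro u hu
    exact ⟨hanti (by simp) hu hu.1, hanti hu (by simp) hu.2⟩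
  refine ⟨K + 1, hs, ha, by linarith, by linarith, h0, h1, ?_, ?_, ?_, ?_, ?_⟩
  · intro u hu
    have := hconc.2 (show (0:ℝ) ∈ Icc (0:ℝ) 1 by simp) (show (1:ℝ) ∈ Icc (0:ℝ) 1 by simp)
      (by norm_num) (show 0 < 1 - u by linarith [hu.2]) hu.1 (by ring)
    simpa [h0, h1] using this
  · intro u hu w hw huw
    exact (convex_Icc (0:ℝ) 1).image_sub_le_mul_sub_of_deriv_le hd.continuous.continuousOn
      hd.differentiableOn (fun x hx => (hder x (interior_subset hx)).1) u hu w hw huw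
  · intro u hu w hw huw
    rw [neg_neg]
    exact (convex_Icc (0:ℝ) 1).mul_sub_le_image_sub_of_le_deriv hd.continuous.continuousOn
      hd.differentiableOn (fun x hx => (hder x (interior_subset hx)).2) u hu w hw huw
  · intro u hu
    have := abs_le.1 (htay 0 (by simp) u hu)
    rw [sq_abs, h0] at this
    nlinarith [this.1, sq_nonneg u]
  · intro u hu
    have := abs_le.1 (htay 1 (by simp) (1 - u) ⟨by linarith [hu.2], by linarith [hu.1]⟩)
    rw [sq_abs, h1] at this
    nlinarith [this.1, sq_nonneg u]

/-- `M v = α v + f (1 - v)` -/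
def Mf (f : ℝ → ℝ) (α v : ℝ) : ℝ := α * v + f (1 - v)

section
variable {f : ℝ → ℝ} {α β C : ℝ}

lemma one_sub_mem {v : ℝ} (hv : v ∈ Icc (0:ℝ) 1) : 1 - v ∈ Icc (0:ℝ) 1 :=
  ⟨by linarith [hv.2], by linarith [hv.1]⟩

lemma NL.M_mono (h : NL f α β C) {v w : ℝ} (hv : v ∈ Icc (0:ℝ) 1) (hw : w ∈ Icc (0:ℝ) 1)
    (hvw : v ≤ w) : Mf f α v ≤ Mf f α w := by
  have := h.up _ (one_sub_mem hw) _ (one_sub_mem hv) (by linarith)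
  unfold Mf; nlinarith

lemma NL.M_up (h : NL f α β C) {v w : ℝ} (hv : v ∈ Icc (0:ℝ) 1) (hw : w ∈ Icc (0:ℝ) 1)
    (hvw : v ≤ w) : Mf f α w - Mf f α v ≤ (α + β) * (w - v) := by
  have := h.low _ (one_sub_mem hw) _ (one_sub_mem hv) (by linarith)
  unfold Mf; nlinarith

lemma NL.M_lip (h : NL f α β C) {v w : ℝ} (hv : v ∈ Icc (0:ℝ) 1) (hw : w ∈ Icc (0:ℝ) 1) :
    |Mf f α w - Mf f α v| ≤ (α + β) * |w - v| := by
  rcases le_total v w with hvw | hvw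
  · rw [abs_of_nonneg (by linarith [h.M_mono hv hw hvw]), abs_of_nonneg (by linarith)]
    exact h.M_up hv hw hvw
  · rw [abs_sub_comm, abs_sub_comm w v, abs_of_nonneg (by linarith [h.M_mono hw hv hvw]),
      abs_of_nonneg (by linarith)]
    exact h.M_up hw hv hvw

lemma NL.M_zero (h : NL f α β C) : Mf f α 0 = 0 := by simp [Mf, h.f1]
lemma NL.M_one (h : NL f α β C) : Mf f α 1 = α := by simp [Mf, h.f0]

lemma NL.M_mem (h : NL f α β C) {v : ℝ} (hv : v ∈ Icc (0:ℝ) 1) : Mf f α v ∈ Icc 0 α := by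
  constructor
  · rw [← h.M_zero]; exact h.M_mono (by simp) hv hv.1
  · conv_rhs => rw [← h.M_one]
    exact h.M_mono hv (by simp) hv.2

lemma NL.M_le (h : NL f α β C) {v : ℝ} (hv : v ∈ Icc (0:ℝ) 1) : Mf f α v ≤ (α + β) * v := by
  have := h.M_up (v := 0) (by simp) hv hv.1
  rw [h.M_zero] at this; linarith

lemma NL.M_ge (h : NL f α β C) {v : ℝ} (hv : v ∈ Icc (0:ℝ) 1) :
    (α + β) * v - C * v ^ 2 ≤ Mf f α v := by
  have := h.quad1 v hv
  unfold Mf; linarith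

lemma NL.M_smooth (h : NL f α β C) : ContDiff ℝ (⊤ : ℕ∞) (Mf f α) := by
  have := h.smooth
  unfold Mf
  fun_prop

lemma NL.M_cont (h : NL f α β C) : Continuous (Mf f α) := h.M_smooth.continuous

end

noncomputable def Qop (η a1 a2 : ℝ) (h : ℝ → ℝ) : ℝ → ℝ :=
  Eop (1 / η) (Eop (1 / η) (Eop a1 (Eop (-a2) h)))

noncomputable def msym (η a1 a2 k : ℝ) : ℝ :=
  (1 + -a2 * k) * (1 + a1 * k) * (1 + 1 / η * k) * (1 + 1 / η * k)

def Adm (η a1 a2 k : ℝ) : Prop := 0 < 1 + -a2 * k ∧ 0 < 1 + a1 * k ∧ 0 < 1 + 1 / η * k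

lemma Adm.pos {η a1 a2 k : ℝ} (h : Adm η a1 a2 k) : 0 < msym η a1 a2 k := by
  obtain ⟨h1, h2, h3⟩ := h; unfold msym; positivity

lemma Qop_le {h : ℝ → ℝ} (hh : BC h) {η a1 a2 k l A B : ℝ} (hk : Adm η a1 a2 k)
    (hl : Adm η a1 a2 l)
    (hle : ∀ x, h x ≤ A * Real.exp (k * x) + B * Real.exp (l * x)) (x : ℝ) :
    Qop η a1 a2 h x ≤ A / msym η a1 a2 k * Real.exp (k * x)
      + B / msym η a1 a2 l * Real.exp (l * x) := by
  have h1 := Eop_le hh hk.1 hl.1 hle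
  have h2 := Eop_le (Eop_bc hh _) hk.2.1 hl.2.1 h1
  have h3 := Eop_le (Eop_bc (Eop_bc hh _) _) hk.2.2 hl.2.2 h2
  have h4 := Eop_le (Eop_bc (Eop_bc (Eop_bc hh _) _) _) hk.2.2 hl.2.2 h3 x
  unfold Qop msym
  simpa only [div_div, mul_assoc] using h4

lemma Qop_bc {h : ℝ → ℝ} (hh : BC h) (η a1 a2 : ℝ) : BC (Qop η a1 a2 h) :=
  Eop_bc (Eop_bc (Eop_bc (Eop_bc hh _) _) _) _

lemma Qop_sub {h g : ℝ → ℝ} (hh : BC h) (hg : BC g) (η a1 a2 x : ℝ) :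
    Qop η a1 a2 (fun y => h y - g y) x = Qop η a1 a2 h x - Qop η a1 a2 g x := by
  unfold Qop
  rw [show Eop (-a2) (fun y => h y - g y) = fun y => Eop (-a2) h y - Eop (-a2) g y from
    funext (Eop_sub hh hg _)]
  have hh := Eop_bc hh (-a2)
  have hg := Eop_bc hg (-a2)
  rw [show Eop a1 (fun y => Eop (-a2) h y - Eop (-a2) g y) = _ from
    funext (Eop_sub hh hg _)]
  have hh := Eop_bc hh (a1)
  have hg := Eop_bc hg (a1)
  rw [show Eop (1 / η) (fun y => Eop a1 (Eop (-a2) h) y - Eop a1 (Eop (-a2) g) y) = _ from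
    funext (Eop_sub hh hg _)]
  exact Eop_sub (Eop_bc hh _) (Eop_bc hg _) _ _

lemma Qop_neg (h : ℝ → ℝ) (η a1 a2 x : ℝ) :
    Qop η a1 a2 (fun y => - h y) x = - Qop η a1 a2 h x := by
  unfold Qop
  rw [show Eop (-a2) (fun y => - h y) = fun y => - Eop (-a2) h y from funext (Eop_neg _ _),
    show Eop a1 (fun y => - Eop (-a2) h y) = _ from funext (Eop_neg _ _),
    show Eop (1 / η) (fun y => - Eop a1 (Eop (-a2) h) y) = _ from funext (Eop_neg _ _)]
  exact Eop_neg _ _ _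

lemma Qop_const (η a1 a2 c x : ℝ) : Qop η a1 a2 (fun _ => c) x = c := by
  unfold Qop
  have h : ∀ a, Eop a (fun _ => c) = fun _ => c := fun a => funext fun y => Eop_const a c y
  rw [h, h, h, h]

lemma adm_zero (η a1 a2 : ℝ) : Adm η a1 a2 0 := by simp [Adm]
lemma msym_zero (η a1 a2 : ℝ) : msym η a1 a2 0 = 1 := by simp [msym]

lemma Qop_abs {h : ℝ → ℝ} (hh : BC h) {η a1 a2 k A : ℝ} (hk : Adm η a1 a2 k)
    (hle : ∀ x, |h x| ≤ A * Real.exp (k * x)) (x : ℝ) :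
    |Qop η a1 a2 h x| ≤ A / msym η a1 a2 k * Real.exp (k * x) := by
  have h1 := Qop_le hh (A := A) (B := 0) hk hk (fun x => by simpa using (abs_le.1 (hle x)).2) x
  have h2 := Qop_le hh.neg (A := A) (B := 0) hk hk
    (fun x => by have := (abs_le.1 (hle x)).1; simp; linarith) x
  rw [Qop_neg] at h2
  rw [abs_le]
  simp at h1 h2
  constructor <;> linarith

lemma Qop_mem {h : ℝ → ℝ} (hc : Continuous h) {lo hi : ℝ} (hb : ∀ x, h x ∈ Icc lo hi)
    (η a1 a2 x : ℝ) : Qop η a1 a2 h x ∈ Icc lo hi := by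
  have hh := BC.of_mem hc hb
  have h1 := Qop_le hh (A := hi) (B := 0) (adm_zero η a1 a2) (adm_zero η a1 a2)
    (fun x => by simpa using (hb x).2) x
  have h2 := Qop_le hh.neg (A := -lo) (B := 0) (adm_zero η a1 a2) (adm_zero η a1 a2)
    (fun x => by simpa using (hb x).1) x
  rw [Qop_neg] at h2
  simp [msym_zero] at h1 h2
  exact ⟨h2, h1⟩

lemma Qop_mono {h : ℝ → ℝ} (hh : BC h) (hm : Monotone h) (η a1 a2 : ℝ) :
    Monotone (Qop η a1 a2 h) :=
  Eop_mono (Eop_bc (Eop_bc (Eop_bc hh _) _) _)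
    (Eop_mono (Eop_bc (Eop_bc hh _) _) (Eop_mono (Eop_bc hh _) (Eop_mono hh hm _) _) _) _

lemma Qop_cont {D : Type*} [TopologicalSpace D] [FirstCountableTopology D] {H : D → ℝ → ℝ}
    {η a1 a2 : D → ℝ} (hH : Continuous (fun p : D × ℝ => H p.1 p.2)) (hη : Continuous η)
    (hη0 : ∀ d, η d ≠ 0)
    (ha1 : Continuous a1) (ha2 : Continuous a2)
    {M : ℝ} (hM : ∀ d x, |H d x| ≤ M) :
    Continuous (fun p : D × ℝ => Qop (η p.1) (a1 p.1) (a2 p.1) (H p.1) p.2) := by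
  have hHc : ∀ d, Continuous (H d) := fun d =>
    hH.comp (by fun_prop : Continuous (fun x : ℝ => (d, x)))
  have hη' : Continuous (fun d => 1 / η d) := continuous_const.div hη hη0
  have h1 := Eop_cont hH ha2.neg hM
  have b1 : ∀ d x, |Eop (-a2 d) (H d) x| ≤ M := fun d => Eop_abs (hHc d) (hM d) _
  have c1 : ∀ d, BC (Eop (-a2 d) (H d)) := fun d => Eop_bc ⟨hHc d, M, hM d⟩ _
  have h2 := Eop_cont h1 ha1 b1
  have b2 : ∀ d x, |Eop (a1 d) (Eop (-a2 d) (H d)) x| ≤ M := fun d =>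
    Eop_abs (c1 d).1 (b1 d) _
  have c2 : ∀ d, BC (Eop (a1 d) (Eop (-a2 d) (H d))) := fun d => Eop_bc (c1 d) _
  have h3 := Eop_cont h2 hη' b2
  have b3 : ∀ d x, |Eop (1 / η d) (Eop (a1 d) (Eop (-a2 d) (H d))) x| ≤ M := fun d =>
    Eop_abs (c2 d).1 (b2 d) _
  exact Eop_cont h3 hη' b3

structure Par (α β Λ η a1 a2 lam : ℝ) : Prop where
  hη : 0 < η
  hη1 : Real.sqrt α ≤ η
  hη2 : η ≤ 5 / 4 * Real.sqrt α
  ha1 : 0 ≤ a1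
  ha1' : a1 * Real.sqrt α ≤ 1 / 3
  ha2 : 0 ≤ a2
  ha2' : a2 * (2 * lam) < 1
  hlam : 0 < lam
  hlam' : lam ≤ Λ
  eig : α * msym η a1 a2 lam = α + β
  eig2 : α + 2 * β ≤ α * msym η a1 a2 (2 * lam)

noncomputable def Vit (f : ℝ → ℝ) (α η a1 a2 lam : ℝ) : ℕ → ℝ → ℝ
  | 0 => fun x => min 1 (Real.exp (lam * x))
  | n + 1 => fun x => 1 / α * Qop η a1 a2 (fun y => Mf f α (Vit f α η a1 a2 lam n y)) x

section
variable {f : ℝ → ℝ} {α β C Λ η a1 a2 lam : ℝ}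

lemma Par.adm1 (hp : Par α β Λ η a1 a2 lam) : Adm η a1 a2 lam := by
  have := hp.hη; have := hp.ha1; have := hp.hlam; have := hp.ha2'; have := hp.ha2
  refine ⟨by nlinarith, by positivity, by positivity⟩

lemma Par.adm2 (hp : Par α β Λ η a1 a2 lam) : Adm η a1 a2 (2 * lam) := by
  have := hp.hη; have := hp.ha1; have := hp.hlam; have := hp.ha2'; have := hp.ha2
  refine ⟨by nlinarith, by positivity, by positivity⟩

lemma scale_mem (hα : 0 < α) {y : ℝ} (hy : y ∈ Icc 0 α) : 1 / α * y ∈ Icc (0:ℝ) 1 := by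
  constructor
  · have := hy.1; positivity
  · rw [one_div, inv_mul_le_iff₀ hα]; simpa using hy.2

lemma Vit_props (hn : NL f α β C) (hp : Par α β Λ η a1 a2 lam) (n : ℕ) :
    Continuous (Vit f α η a1 a2 lam n) ∧ (∀ x, Vit f α η a1 a2 lam n x ∈ Icc (0:ℝ) 1) ∧
      Monotone (Vit f α η a1 a2 lam n) := by
  induction n with
  | zero =>
    refine ⟨?_, ?_, ?_⟩
    · unfold Vit; fun_prop
    · intro x; exact ⟨le_min zero_le_one (Real.exp_pos _).le, min_le_left _ _⟩
    · intro x y hxy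
      have := hp.hlam
      exact min_le_min le_rfl (Real.exp_le_exp.2 (by nlinarith))
  | succ n ih =>
    obtain ⟨h1, h2, h3⟩ := ih
    have hc : Continuous (fun y => Mf f α (Vit f α η a1 a2 lam n y)) := hn.M_cont.comp h1
    have hm : ∀ y, Mf f α (Vit f α η a1 a2 lam n y) ∈ Icc 0 α := fun y => hn.M_mem (h2 y)
    have hbc := BC.of_mem hc hm
    refine ⟨?_, ?_, ?_⟩
    · exact continuous_const.mul (Qop_bc hbc _ _ _).1
    · intro x
      exact scale_mem hn.hα (Qop_mem hc hm _ _ _ _)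
    · have : Monotone (fun y => Mf f α (Vit f α η a1 a2 lam n y)) := fun x y hxy =>
        hn.M_mono (h2 x) (h2 y) (h3 hxy)
      intro x y hxy
      exact mul_le_mul_of_nonneg_left (Qop_mono hbc this _ _ _ hxy) (by have := hn.hα; positivity)

lemma MV_bc (hn : NL f α β C) {v : ℝ → ℝ} (hv : Continuous v) (hb : ∀ x, v x ∈ Icc (0:ℝ) 1) :
    BC (fun y => Mf f α (v y)) := BC.of_mem (hn.M_cont.comp hv) (fun y => hn.M_mem (hb y))

noncomputable def theta (α β : ℝ) : ℝ := (α + β) / (α + 2 * β)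

lemma theta_pos (hn : NL f α β C) : 0 < theta α β := by
  have := hn.hα; have := hn.hβ; unfold theta; positivity
lemma theta_lt (hn : NL f α β C) : theta α β < 1 := by
  have := hn.hα; have := hn.hβ; unfold theta; rw [div_lt_one (by positivity)]; linarith

/-- contraction -/
lemma contr (hn : NL f α β C) (hp : Par α β Λ η a1 a2 lam) {v w : ℝ → ℝ}
    (hv : Continuous v) (hbv : ∀ x, v x ∈ Icc (0:ℝ) 1)
    (hw : Continuous w) (hbw : ∀ x, w x ∈ Icc (0:ℝ) 1) {K : ℝ} (hK : 0 ≤ K)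
    (h : ∀ x, |v x - w x| ≤ K * Real.exp (2 * lam * x)) (x : ℝ) :
    |1 / α * Qop η a1 a2 (fun y => Mf f α (v y)) x - 1 / α * Qop η a1 a2 (fun y => Mf f α (w y)) x|
      ≤ K * theta α β * Real.exp (2 * lam * x) := by
  have hα := hn.hα
  have hβ := hn.hβ
  have b1 := MV_bc hn hv hbv
  have b2 := MV_bc hn hw hbw
  have := Qop_abs (b1.sub b2) (A := (α + β) * K) hp.adm2 (fun x => by
    refine (hn.M_lip (hbw x) (hbv x)).trans ?_
    rw [mul_assoc]
    exact mul_le_mul_of_nonneg_left (h x) (by positivity)) x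
  rw [Qop_sub b1 b2] at this
  rw [← mul_sub, abs_mul, abs_of_pos (by positivity)]
  have hm := hp.adm2.pos
  calc _ ≤ 1 / α * ((α + β) * K / msym η a1 a2 (2 * lam) * Real.exp (2 * lam * x)) :=
        mul_le_mul_of_nonneg_left this (by positivity)
    _ = K * ((α + β) / (α * msym η a1 a2 (2 * lam))) * Real.exp (2 * lam * x) := by
        field_simp
    _ ≤ _ := by
        refine mul_le_mul_of_nonneg_right ?_ (Real.exp_pos _).le
        refine mul_le_mul_of_nonneg_left ?_ hK
        unfold theta
        exact div_le_div_of_nonneg_left (by positivity) (by positivity) hp.eig2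

lemma V0_bounds (_hp : 0 < lam) (x : ℝ) :
    min 1 (Real.exp (lam * x)) ≤ Real.exp (lam * x) ∧
    Real.exp (lam * x) - Real.exp (2 * lam * x) ≤ min 1 (Real.exp (lam * x)) ∧
    (min 1 (Real.exp (lam * x))) ^ 2 ≤ Real.exp (2 * lam * x) := by
  have e : Real.exp (2 * lam * x) = Real.exp (lam * x) ^ 2 := by
    rw [← Real.exp_nat_mul]; congr 1; push_cast; ring
  rw [e]
  set t := Real.exp (lam * x)
  have ht : 0 < t := Real.exp_pos _
  refine ⟨min_le_right _ _, ?_, ?_⟩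
  · refine le_min ?_ ?_ <;> nlinarith [sq_nonneg (t - 1)]
  · exact pow_le_pow_left₀ (le_min zero_le_one ht.le) (min_le_right _ _) 2

lemma V1_V0 (hn : NL f α β C) (hp : Par α β Λ η a1 a2 lam) (x : ℝ) :
    |Vit f α η a1 a2 lam 0 x - Vit f α η a1 a2 lam 1 x| ≤
      (1 + (α + β + C) / α) * Real.exp (2 * lam * x) := by
  have hα := hn.hα
  have hβ := hn.hβ
  have hC := hn.hC
  obtain ⟨p1, p2, p3⟩ := Vit_props hn hp 0
  have hbc := MV_bc hn p1 p2
  have e0 : ∀ x, Vit f α η a1 a2 lam 0 x = min 1 (Real.exp (lam * x)) := fun x => rfl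
  have e1 : Vit f α η a1 a2 lam 1 x =
    1 / α * Qop η a1 a2 (fun y => Mf f α (Vit f α η a1 a2 lam 0 y)) x := rfl
  have up := Qop_le hbc (A := α + β) (B := 0) hp.adm1 hp.adm1 (fun x => by
    refine (hn.M_le (p2 x)).trans ?_
    rw [e0]
    have := (V0_bounds hp.hlam x).1
    simp only [zero_mul, add_zero]
    exact mul_le_mul_of_nonneg_left this (by positivity)) x
  have lo := Qop_le hbc.neg (A := -(α + β)) (B := α + β + C) hp.adm1 hp.adm2 (fun x => by
    have h1 := hn.M_ge (p2 x)
    rw [e0] at h1 ⊢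
    obtain ⟨-, h2, h3⟩ := V0_bounds hp.hlam x
    have h4 := mul_le_mul_of_nonneg_left h2 (by positivity : 0 ≤ α + β)
    have h5 := mul_le_mul_of_nonneg_left h3 hC.le
    nlinarith) x
  rw [Qop_neg] at lo
  have m1 := hp.adm1.pos
  have m2 := hp.adm2.pos
  have u1 : Vit f α η a1 a2 lam 1 x ≤ Real.exp (lam * x) := by
    rw [e1]
    have h := mul_le_mul_of_nonneg_left up (by positivity : 0 ≤ 1 / α)
    refine h.trans (le_of_eq ?_)
    rw [← hp.eig]; field_simp; ring
  have l1 : Real.exp (lam * x) - (α + β + C) / α * Real.exp (2 * lam * x)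
      ≤ Vit f α η a1 a2 lam 1 x := by
    rw [e1]
    have h := mul_le_mul_of_nonneg_left lo (by positivity : 0 ≤ 1 / α)
    have e2 : 1 / α * (-(α + β) / msym η a1 a2 lam * Real.exp (lam * x)) = - Real.exp (lam * x) := by
      rw [← hp.eig]; field_simp
    have h3 : (α + β + C) / msym η a1 a2 (2 * lam) * Real.exp (2 * lam * x) ≤
        (α + β + C) * Real.exp (2 * lam * x) := by
      refine mul_le_mul_of_nonneg_right ?_ (Real.exp_pos _).le
      refine div_le_self (by positivity) ?_
      have := hp.eig2
      by_contra hlt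
      push Not at hlt
      nlinarith
    have h4 := mul_le_mul_of_nonneg_left h3 (by positivity : 0 ≤ 1 / α)
    rw [mul_add, e2] at h
    have e5 : 1 / α * ((α + β + C) * Real.exp (2 * lam * x)) =
      (α + β + C) / α * Real.exp (2 * lam * x) := by ring
    rw [e5] at h4
    linarith
  obtain ⟨b1, b2, b3⟩ := V0_bounds hp.hlam x
  rw [← e0] at b1 b2
  have hX := Real.exp_pos (2 * lam * x)
  have : 0 < (α + β + C) / α := by positivity
  rw [abs_le]
  constructor <;> nlinarith

noncomputable def C1 (α β C : ℝ) : ℝ := 1 + (α + β + C) / α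

lemma Vit_geom (hn : NL f α β C) (hp : Par α β Λ η a1 a2 lam) (n : ℕ) (x : ℝ) :
    |Vit f α η a1 a2 lam n x - Vit f α η a1 a2 lam (n + 1) x| ≤
      C1 α β C * theta α β ^ n * Real.exp (2 * lam * x) := by
  induction n generalizing x with
  | zero => simpa [C1] using V1_V0 hn hp x
  | succ n ih =>
    obtain ⟨p1, p2, p3⟩ := Vit_props hn hp n
    obtain ⟨q1, q2, q3⟩ := Vit_props hn hp (n + 1)
    have : 0 ≤ C1 α β C := by
      have := hn.hα; have := hn.hβ; have := hn.hC; unfold C1; positivity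
    have := contr hn hp p1 p2 q1 q2 (mul_nonneg this (pow_nonneg (theta_pos hn).le n)) ih x
    rw [pow_succ, ← mul_assoc]
    exact this

noncomputable def C2 (α β C : ℝ) : ℝ := C1 α β C / (1 - theta α β)

lemma Vit_lim (hn : NL f α β C) (hp : Par α β Λ η a1 a2 lam) :
    ∃ W : ℝ → ℝ, ∀ n x, |Vit f α η a1 a2 lam n x - W x| ≤
      C2 α β C * theta α β ^ n * Real.exp (2 * lam * x) := by
  have hd : ∀ x n, dist (Vit f α η a1 a2 lam n x) (Vit f α η a1 a2 lam (n + 1) x) ≤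
      (C1 α β C * Real.exp (2 * lam * x)) * theta α β ^ n := by
    intro x n
    rw [Real.dist_eq]
    exact (Vit_geom hn hp n x).trans (le_of_eq (by ring))
  have hex : ∀ x, ∃ y, Tendsto (fun n => Vit f α η a1 a2 lam n x) atTop (𝓝 y) := fun x =>
    cauchySeq_tendsto_of_complete (cauchySeq_of_le_geometric _ _ (theta_lt hn) (hd x))
  choose W hW using hex
  refine ⟨W, fun n x => ?_⟩
  have := dist_le_of_le_geometric_of_tendsto _ _ (theta_lt hn) (hd x) (hW x) n
  rw [Real.dist_eq] at this
  refine this.trans (le_of_eq ?_)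
  unfold C2; ring

end

/-- raw fronts -/
lemma raw_front {D : Type*} [TopologicalSpace D] [FirstCountableTopology D]
    {f : ℝ → ℝ} {α β C Λ : ℝ} {η a1 a2 lam : D → ℝ}
    (hn : NL f α β C) (hp : ∀ d, Par α β Λ (η d) (a1 d) (a2 d) (lam d))
    (cη : Continuous η) (ca1 : Continuous a1) (ca2 : Continuous a2) (clam : Continuous lam) :
    ∃ W : D → ℝ → ℝ, Continuous (fun p : D × ℝ => W p.1 p.2) ∧
      (∀ d x, W d x ∈ Icc (0:ℝ) 1) ∧ (∀ d, Monotone (W d)) ∧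
      (∀ d x, W d x = 1 / α * Qop (η d) (a1 d) (a2 d) (fun y => Mf f α (W d y)) x) ∧
      (∀ d x, |min 1 (Real.exp (lam d * x)) - W d x| ≤ C2 α β C * Real.exp (2 * lam d * x)) := by
  have hex := fun d => Vit_lim hn (hp d)
  choose W hW using hex
  have hC2 : 0 ≤ C2 α β C := by
    have := hn.hα; have := hn.hβ; have := hn.hC; have := theta_lt hn
    have : 0 < 1 - theta α β := by linarith
    unfold C2 C1; positivity
  have hθ := tendsto_pow_atTop_nhds_zero_of_lt_one (theta_pos hn).le (theta_lt hn)
  have hgeo : ∀ K : ℝ, Tendsto (fun n => C2 α β C * theta α β ^ n * K) atTop (𝓝 0) := by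
    intro K
    have := (hθ.const_mul (C2 α β C)).mul_const K
    simpa using this
  have hpt : ∀ d x, Tendsto (fun n => Vit f α (η d) (a1 d) (a2 d) (lam d) n x) atTop (𝓝 (W d x)) := by
    intro d x
    rw [tendsto_iff_dist_tendsto_zero]
    exact squeeze_zero (fun _ => dist_nonneg) (fun n => by
      rw [Real.dist_eq]; exact hW d n x) (hgeo _)
  have hmem : ∀ d x, W d x ∈ Icc (0:ℝ) 1 := fun d x =>
    isClosed_Icc.mem_of_tendsto (hpt d x) (Eventually.of_forall fun n => (Vit_props hn (hp d) n).2.1 x)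
  have hmono : ∀ d, Monotone (W d) := fun d x y hxy =>
    le_of_tendsto_of_tendsto' (hpt d x) (hpt d y) (fun n => (Vit_props hn (hp d) n).2.2 hxy)
  have hVc : ∀ n, Continuous (fun p : D × ℝ => Vit f α (η p.1) (a1 p.1) (a2 p.1) (lam p.1) n p.2) := by
    intro n
    induction n with
    | zero => unfold Vit; fun_prop
    | succ n ih =>
      refine continuous_const.mul ?_
      refine Qop_cont (H := fun d y => Mf f α (Vit f α (η d) (a1 d) (a2 d) (lam d) n y))
        (M := α) (hn.M_cont.comp ih) cη (fun d => (hp d).hη.ne') ca1 ca2 ?_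
      intro d x
      have := hn.M_mem ((Vit_props hn (hp d) n).2.1 x)
      rw [abs_of_nonneg this.1]; exact this.2
  have hcont : Continuous (fun p : D × ℝ => W p.1 p.2) := by
    refine continuous_of_locally_uniform_approx_of_continuousAt ?_
    rintro ⟨d0, x0⟩ u hu
    obtain ⟨ε, hε, hεu⟩ := Metric.mem_uniformity_dist.1 hu
    obtain ⟨n, hn'⟩ := ((hgeo (Real.exp (2 * Λ * (|x0| + 1)))).eventually (gt_mem_nhds hε)).exists
    refine ⟨{p | p.2 < x0 + 1}, ?_, _, (hVc n).continuousAt, ?_⟩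
    · exact (isOpen_lt continuous_snd continuous_const).mem_nhds (by simp)
    · rintro ⟨d, x⟩ hx
      apply hεu
      rw [dist_comm, Real.dist_eq]
      refine (hW d n x).trans_lt (lt_of_le_of_lt ?_ hn')
      refine mul_le_mul_of_nonneg_left ?_ (mul_nonneg hC2 (pow_nonneg (theta_pos hn).le n))
      apply Real.exp_le_exp.2
      have h1 : x ≤ |x0| + 1 := by
        have : x < x0 + 1 := hx
        linarith [le_abs_self x0]
      have h2 := (hp d).hlam
      have h3 := (hp d).hlam'
      have : 0 ≤ |x0| := abs_nonneg _
      nlinarith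
  have hcd : ∀ d, Continuous (W d) := fun d =>
    hcont.comp (by fun_prop : Continuous (fun x : ℝ => (d, x)))
  refine ⟨W, hcont, hmem, hmono, ?_, ?_⟩
  · intro d x
    have h1 : Tendsto (fun n => Vit f α (η d) (a1 d) (a2 d) (lam d) (n + 1) x) atTop (𝓝 (W d x)) :=
      (hpt d x).comp (tendsto_add_atTop_nat 1)
    refine tendsto_nhds_unique h1 ?_
    rw [tendsto_iff_dist_tendsto_zero]
    refine squeeze_zero (fun _ => dist_nonneg) (fun n => ?_)
      (hgeo (theta α β * Real.exp (2 * lam d * x)))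
    obtain ⟨p1, p2, -⟩ := Vit_props hn (hp d) n
    have := contr hn (hp d) p1 p2 (hcd d) (hmem d)
      (mul_nonneg hC2 (pow_nonneg (theta_pos hn).le n)) (hW d n) x
    rw [Real.dist_eq]
    refine le_trans this (le_of_eq (by ring))
  · intro d x
    have := hW d 0 x
    rw [pow_zero, mul_one] at this
    exact this

lemma Eop_tendsto {h : ℝ → ℝ} (hh : BC h) {l : ℝ} (hl : Tendsto h atTop (𝓝 l)) (a : ℝ) :
    Tendsto (Eop a h) atTop (𝓝 l) := by
  obtain ⟨hc, M, hM⟩ := hh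
  have h1 : IntegrableOn (fun s => Real.exp (-s)) (Ioi (0:ℝ)) := by
    simpa using exp_int (k := 1) one_pos
  rw [← Eop_const a l 0]
  refine tendsto_integral_filter_of_dominated_convergence (fun s => Real.exp (-s) * M) ?_ ?_
    (h1.mul_const M) ?_
  · exact Eventually.of_forall fun x =>
      (by fun_prop : Continuous (fun s : ℝ => Real.exp (-s) * h (x - a * s))).aestronglyMeasurable
  · refine Eventually.of_forall fun x => Eventually.of_forall fun s => ?_
    rw [norm_mul, Real.norm_eq_abs, Real.norm_eq_abs, abs_of_pos (Real.exp_pos _)]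
    exact mul_le_mul_of_nonneg_left (hM _) (Real.exp_pos _).le
  · refine Eventually.of_forall fun s => ?_
    refine Tendsto.const_mul _ (hl.comp ?_)
    exact tendsto_atTop_add_const_right _ _ tendsto_id

lemma Qop_tendsto {h : ℝ → ℝ} (hh : BC h) {l : ℝ} (hl : Tendsto h atTop (𝓝 l)) (η a1 a2 : ℝ) :
    Tendsto (Qop η a1 a2 h) atTop (𝓝 l) :=
  Eop_tendsto (Eop_bc (Eop_bc (Eop_bc hh _) _) _) (Eop_tendsto (Eop_bc (Eop_bc hh _) _)
    (Eop_tendsto (Eop_bc hh _) (Eop_tendsto hh hl _) _) _) _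

section
variable {f : ℝ → ℝ} {α β C Λ η a1 a2 lam : ℝ}

lemma W_atBot (hp : Par α β Λ η a1 a2 lam) {W : ℝ → ℝ} {K : ℝ}
    (hb : ∀ x, W x ∈ Icc (0:ℝ) 1)
    (h : ∀ x, |min 1 (Real.exp (lam * x)) - W x| ≤ K * Real.exp (2 * lam * x)) :
    Tendsto W atBot (𝓝 0) := by
  have hl := hp.hlam
  have e : ∀ k : ℝ, 0 < k → Tendsto (fun x => Real.exp (k * x)) atBot (𝓝 0) := fun k hk =>
    Real.tendsto_exp_atBot.comp (tendsto_id.const_mul_atBot hk)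
  have t : Tendsto (fun x => Real.exp (lam * x) + K * Real.exp (2 * lam * x)) atBot (𝓝 0) := by
    have := (e lam hl).add ((e (2 * lam) (by positivity)).const_mul K)
    simpa using this
  refine squeeze_zero (fun x => (hb x).1) (fun x => ?_) t
  have := (abs_le.1 (h x)).1
  linarith [min_le_right 1 (Real.exp (lam * x))]

lemma W_atTop (hn : NL f α β C) (hp : Par α β Λ η a1 a2 lam) {W : ℝ → ℝ} {K : ℝ}
    (hc : Continuous W)
    (hb : ∀ x, W x ∈ Icc (0:ℝ) 1) (hm : Monotone W)
    (hfix : ∀ x, W x = 1 / α * Qop η a1 a2 (fun y => Mf f α (W y)) x)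
    (h : ∀ x, |min 1 (Real.exp (lam * x)) - W x| ≤ K * Real.exp (2 * lam * x)) :
    Tendsto W atTop (𝓝 1) := by
  have hα := hn.hα
  have hl := hp.hlam
  have hbd : BddAbove (range W) := ⟨1, by rintro _ ⟨x, rfl⟩; exact (hb x).2⟩
  have ht := tendsto_atTop_ciSup hm hbd
  set L := ⨆ x, W x with hL
  have hLmem : L ∈ Icc (0:ℝ) 1 := isClosed_Icc.mem_of_tendsto ht (Eventually.of_forall hb)
  have hMt : Tendsto (fun y => Mf f α (W y)) atTop (𝓝 (Mf f α L)) :=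
    (hn.M_cont.tendsto L).comp ht
  have h2 := (Qop_tendsto (MV_bc hn hc hb) hMt η a1 a2).const_mul (1 / α)
  have h3 : L = 1 / α * Mf f α L := by
    refine tendsto_nhds_unique ht ?_
    rw [show W = fun x => 1 / α * Qop η a1 a2 (fun y => Mf f α (W y)) x from funext hfix]
    exact h2
  have h4 : f (1 - L) = 0 := by
    unfold Mf at h3
    field_simp at h3
    linarith
  have hLpos : 0 < L := by
    obtain ⟨x, hx, hx0⟩ : ∃ x : ℝ, K * Real.exp (lam * x) < 1 ∧ x ≤ 0 := by
      have t : Tendsto (fun x => K * Real.exp (lam * x)) atBot (𝓝 0) := by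
        have := (Real.tendsto_exp_atBot.comp (tendsto_id.const_mul_atBot hl)).const_mul K
        simpa using this
      exact ((t.eventually (gt_mem_nhds one_pos)).and (eventually_le_atBot 0)).exists
    have h5 := (abs_le.1 (h x)).2
    have e : Real.exp (2 * lam * x) = Real.exp (lam * x) * Real.exp (lam * x) := by
      rw [← Real.exp_add]; congr 1; ring
    have h6 : min 1 (Real.exp (lam * x)) = Real.exp (lam * x) :=
      min_eq_right (Real.exp_le_one_iff.2 (by nlinarith))
    rw [h6, e] at h5
    have h7 := Real.exp_pos (lam * x)
    have : 0 < W x := by nlinarith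
    exact this.trans_le (le_ciSup hbd x)
  have : L = 1 := by
    by_contra hne
    have hlt : L < 1 := lt_of_le_of_ne hLmem.2 hne
    have := hn.pos (1 - L) ⟨by linarith, by linarith⟩
    linarith
  rwa [this] at ht

/-- properties of a front, as a solution of the integral equation -/
structure Fr (f : ℝ → ℝ) (α η a1 a2 : ℝ) (q : ℝ → ℝ) : Prop where
  cont : Continuous q
  mem : ∀ x, q x ∈ Icc (0:ℝ) 1
  anti : Antitone q
  bot : Tendsto q atBot (𝓝 1)
  top : Tendsto q atTop (𝓝 0)
  fix : ∀ x, α * q x = Qop η a1 a2 (fun y => α * q y - f (q y)) x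

lemma W_Fr (hn : NL f α β C) (hp : Par α β Λ η a1 a2 lam) {W : ℝ → ℝ} {K : ℝ}
    (hc : Continuous W)
    (hb : ∀ x, W x ∈ Icc (0:ℝ) 1) (hm : Monotone W)
    (hfix : ∀ x, W x = 1 / α * Qop η a1 a2 (fun y => Mf f α (W y)) x)
    (h : ∀ x, |min 1 (Real.exp (lam * x)) - W x| ≤ K * Real.exp (2 * lam * x)) :
    Fr f α η a1 a2 (fun x => 1 - W x) := by
  have hα := hn.hα
  refine ⟨by fun_prop, fun x => one_sub_mem (hb x), fun x y hxy => by
    have := hm hxy; linarith, ?_, ?_, ?_⟩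
  · simpa using (W_atBot hp hb h).const_sub 1
  · simpa using (W_atTop hn hp hc hb hm hfix h).const_sub 1
  · intro x
    have e : (fun y => α * (1 - W y) - f (1 - W y)) = fun y => α - Mf f α (W y) := by
      ext y; unfold Mf; ring
    rw [e, Qop_sub (h := fun _ => α) ⟨continuous_const, |α|, fun _ => le_rfl⟩ (MV_bc hn hc hb),
      Qop_const]
    have := hfix x
    field_simp at this
    linarith

lemma NL.N_mem (hn : NL f α β C) {u : ℝ} (hu : u ∈ Icc (0:ℝ) 1) : α * u - f u ∈ Icc 0 α := by
  have := hn.M_mem (one_sub_mem hu)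
  unfold Mf at this
  rw [sub_sub_cancel] at this
  exact ⟨by linarith [this.2], by linarith [this.1]⟩

lemma Fr.bcN (hn : NL f α β C) {q : ℝ → ℝ} (hq : Fr f α η a1 a2 q) :
    BC (fun y => α * q y - f (q y)) := by
  have := hn.smooth.continuous
  have := hq.cont
  exact BC.of_mem (by fun_prop) (fun x => hn.N_mem (hq.mem x))

noncomputable def sg (α : ℝ) : ℝ := 3 / 4 * Real.sqrt α

lemma Fr.decay (hn : NL f α β C) (hp : Par α β Λ η a1 a2 lam) {q : ℝ → ℝ}
    (hq : Fr f α η a1 a2 q) {X : ℝ} (hX : q X ≤ α / (64 * C)) (x : ℝ) :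
    q x ≤ 64 * Real.exp (sg α * X) * Real.exp (-sg α * x) := by
  have hα := hn.hα
  have hC := hn.hC
  have hs : 0 < Real.sqrt α := Real.sqrt_pos.2 hα
  have hσ : 0 < sg α := by unfold sg; positivity
  have f1 : 1 ≤ 1 + -a2 * -sg α := by have := hp.ha2; nlinarith
  have f2 : 3 / 4 ≤ 1 + a1 * -sg α := by have := hp.ha1'; unfold sg; nlinarith
  have f3 : 1 / 4 ≤ 1 + 1 / η * -sg α := by
    have h1 := hp.hη1; have h2 := hp.hη
    have : Real.sqrt α / η ≤ 1 := by rw [div_le_one h2]; exact h1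
    have e : 1 / η * -sg α = -(3 / 4) * (Real.sqrt α / η) := by unfold sg; ring
    rw [e]; linarith
  have adm : Adm η a1 a2 (-sg α) := ⟨by linarith, by linarith, by linarith⟩
  have hm : 3 / 64 ≤ msym η a1 a2 (-sg α) := by
    unfold msym
    calc (3:ℝ) / 64 = 1 * (3 / 4) * (1 / 4) * (1 / 4) := by norm_num
      _ ≤ _ := by gcongr
  set E := Real.exp (sg α * X) with hE
  have hEpos : 0 < E := Real.exp_pos _
  have key : ∀ n : ℕ, ∀ x, q x ≤ 64 * E * Real.exp (-sg α * x) + (1 / 64) ^ n := by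
    intro n
    induction n with
    | zero =>
      intro x
      have := (hq.mem x).2
      have := Real.exp_pos (-sg α * x)
      have : 0 < 64 * E * Real.exp (-sg α * x) := by positivity
      rw [pow_zero]; linarith
    | succ n ih =>
      intro x
      have hN : ∀ y, α * q y - f (q y) ≤ 2 * α * E * Real.exp (-sg α * y)
          + α * (1 / 64) ^ (n + 1) * Real.exp (0 * y) := by
        intro y
        have hy := ih y
        have hpos := Real.exp_pos (-sg α * y)
        have hpw : (0:ℝ) < (1 / 64) ^ n := by positivity
        rw [zero_mul, Real.exp_zero, mul_one, pow_succ]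
        rcases le_total X y with hXy | hXy
        · have h1 : q y ≤ α / (64 * C) := (hq.anti hXy).trans hX
          have h2 := hn.quad0 _ (hq.mem y)
          have h3 : C * q y ^ 2 ≤ α / 64 * q y := by
            have := mul_le_mul_of_nonneg_left h1 (mul_nonneg hC.le (hq.mem y).1)
            calc C * q y ^ 2 = C * q y * q y := by ring
              _ ≤ _ := this
              _ = _ := by field_simp
          have h4 := mul_le_mul_of_nonneg_left hy (by positivity : 0 ≤ α / 64)
          have : 0 < α * E * Real.exp (-sg α * y) := by positivity
          nlinarith
        · have h1 := (hn.N_mem (hq.mem y)).2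
          have h2 : 1 ≤ E * Real.exp (-sg α * y) := by
            rw [hE, ← Real.exp_add]
            apply Real.one_le_exp
            nlinarith
          have : 0 < α * ((1 / 64) ^ n * (1 / 64)) := by positivity
          nlinarith
      have h5 := Qop_le (hq.bcN hn) adm (adm_zero η a1 a2) hN x
      rw [← hq.fix, msym_zero, zero_mul, Real.exp_zero, mul_one, div_one] at h5
      have h6 : 2 * α * E / msym η a1 a2 (-sg α) ≤ α * (64 * E) := by
        rw [div_le_iff₀ adm.pos]
        have : 0 < α * E := by positivity
        nlinarith
      have h7 := mul_le_mul_of_nonneg_right h6 (Real.exp_pos (-sg α * x)).le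
      have h8 : α * q x ≤ α * (64 * E * Real.exp (-sg α * x) + (1 / 64) ^ (n + 1)) := by
        nlinarith
      exact le_of_mul_le_mul_left h8 hα
  have ht : Tendsto (fun n : ℕ => 64 * E * Real.exp (-sg α * x) + (1 / 64 : ℝ) ^ n) atTop
      (𝓝 (64 * E * Real.exp (-sg α * x) + 0)) :=
    (tendsto_pow_atTop_nhds_zero_of_lt_one (by norm_num) (by norm_num)).const_add _
  rw [add_zero] at ht
  exact ge_of_tendsto' ht (fun n => key n x)

/-- `u2` -/
noncomputable def U2 (f : ℝ → ℝ) (α a1 a2 : ℝ) (q : ℝ → ℝ) : ℝ → ℝ :=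
  Eop a1 (Eop (-a2) (fun y => α * q y - f (q y)))

lemma Fr.U2_bc (hn : NL f α β C) {q : ℝ → ℝ} (hq : Fr f α η a1 a2 q) :
    BC (U2 f α a1 a2 q) := Eop_bc (Eop_bc (hq.bcN hn) _) _

lemma Fr.U2_nonneg (hn : NL f α β C) {q : ℝ → ℝ} (hq : Fr f α η a1 a2 q) (x : ℝ) :
    0 ≤ U2 f α a1 a2 q x :=
  Eop_ge' (Eop_bc (hq.bcN hn) _) (Eop_ge' (hq.bcN hn) (fun y => (hn.N_mem (hq.mem y)).1) _) _ _

lemma Fr.U2_le (hn : NL f α β C) (hp : Par α β Λ η a1 a2 lam) {q : ℝ → ℝ}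
    (hq : Fr f α η a1 a2 q) {X : ℝ} (hX : q X ≤ α / (64 * C)) (x : ℝ) :
    U2 f α a1 a2 q x ≤ 2 * C * (64 * Real.exp (sg α * X)) ^ 2 * Real.exp (-(2 * sg α) * x) := by
  have hα := hn.hα
  have hC := hn.hC
  have hs : 0 < Real.sqrt α := Real.sqrt_pos.2 hα
  have hσ : 0 < sg α := by unfold sg; positivity
  have f1 : 1 ≤ 1 + -a2 * -(2 * sg α) := by have := hp.ha2; nlinarith
  have f2 : 1 / 2 ≤ 1 + a1 * -(2 * sg α) := by have := hp.ha1'; unfold sg; nlinarith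
  set G := 64 * Real.exp (sg α * X) with hG
  have h0 : ∀ y, α * q y - f (q y) ≤ C * G ^ 2 * Real.exp (-(2 * sg α) * y)
      + 0 * Real.exp (-(2 * sg α) * y) := by
    intro y
    have h1 := hn.quad0 _ (hq.mem y)
    have h2 := pow_le_pow_left₀ (hq.mem y).1 (hq.decay hn hp hX y) 2
    rw [mul_pow, ← Real.exp_nat_mul] at h2
    have e : Real.exp (((2:ℕ):ℝ) * (-sg α * y)) = Real.exp (-(2 * sg α) * y) := by
      congr 1; push_cast; ring
    rw [e] at h2
    nlinarith
  have g1 : 0 < 1 + -a2 * -(2 * sg α) := by linarith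
  have g2 : 0 < 1 + a1 * -(2 * sg α) := by linarith
  have h1 := Eop_le (hq.bcN hn) g1 g1 h0
  have h2 := Eop_le (Eop_bc (hq.bcN hn) _) g2 g2 h1 x
  refine h2.trans ?_
  have hD : C * G ^ 2 / (1 + -a2 * -(2 * sg α)) / (1 + a1 * -(2 * sg α)) ≤ 2 * C * G ^ 2 := by
    rw [div_div, div_le_iff₀ (by nlinarith)]
    have : 0 ≤ C * G ^ 2 := by positivity
    have h5 : 1 / 2 ≤ (1 + -a2 * -(2 * sg α)) * (1 + a1 * -(2 * sg α)) := by nlinarith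
    nlinarith
  have := mul_le_mul_of_nonneg_right hD (Real.exp_pos (-(2 * sg α) * x)).le
  simpa using this

end

/-! asymptotics -/

lemma small_of_deriv {F F' : ℝ → ℝ} (hF : ∀ x, HasDerivAt F (F' x) x)
    (h0 : Tendsto F atTop (𝓝 0)) {K ν : ℝ} (hν : 0 < ν)
    (hb : ∀ x, |F' x| ≤ K * Real.exp (-ν * x)) (x : ℝ) :
    |F x| ≤ K / ν * Real.exp (-ν * x) := by
  have hE : ∀ x, HasDerivAt (fun x => K / ν * Real.exp (-ν * x)) (-(K * Real.exp (-ν * x))) x := by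
    intro x
    have := (((hasDerivAt_id x).const_mul (-ν)).exp).const_mul (K / ν)
    refine this.congr_deriv ?_
    simp only [id]; field_simp
  have hEt : Tendsto (fun x => K / ν * Real.exp (-ν * x)) atTop (𝓝 0) := by
    have := (Real.tendsto_exp_atBot.comp
      ((tendsto_id (α := ℝ)).const_mul_atTop_of_neg (by linarith : -ν < 0))).const_mul (K / ν)
    simpa using this
  have a1 : Antitone (fun x => F x + K / ν * Real.exp (-ν * x)) := by
    refine antitone_of_hasDerivAt_nonpos (fun x => (hF x).add (hE x)) ?_
    intro x; have := (abs_le.1 (hb x)).2; simp only [Pi.zero_apply]; linarith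
  have a2 : Monotone (fun x => F x - K / ν * Real.exp (-ν * x)) := by
    refine monotone_of_hasDerivAt_nonneg (fun x => (hF x).sub (hE x)) ?_
    intro x; have := (abs_le.1 (hb x)).1; simp only [Pi.zero_apply]; linarith
  have t1 := h0.add hEt
  have t2 := h0.sub hEt
  have g1 := a1.le_of_tendsto t1 x
  have g2 := a2.ge_of_tendsto t2 x
  rw [abs_le]
  constructor <;> linarith

lemma mul_exp_le {ν y : ℝ} (hν : 0 < ν) : y * Real.exp (-ν * y) ≤ 2 / ν * Real.exp (-(ν / 2) * y) := by
  have h1 : ν / 2 * y ≤ Real.exp (ν / 2 * y) := by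
    have := Real.add_one_le_exp (ν / 2 * y); linarith
  have h2 : Real.exp (-ν * y) = Real.exp (-(ν / 2) * y) * Real.exp (-(ν / 2 * y)) := by
    rw [← Real.exp_add]; congr 1; ring
  have h3 : Real.exp (ν / 2 * y) * Real.exp (-(ν / 2 * y)) = 1 := by rw [← Real.exp_add]; simp
  have h4 := mul_le_mul_of_nonneg_right h1 (Real.exp_pos (-(ν / 2 * y))).le
  rw [h3] at h4
  have h5 : y * Real.exp (-(ν / 2 * y)) ≤ 2 / ν := by
    rw [le_div_iff₀ hν]; nlinarith
  rw [h2]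
  have := mul_le_mul_of_nonneg_right h5 (Real.exp_pos (-(ν / 2) * y)).le
  nlinarith

lemma exp_int2 {k : ℝ} (hk : 0 < k) : IntegrableOn (fun s => Real.exp (-k * s)) (Ioi (0:ℝ)) :=
  exp_neg_integrableOn_Ioi 0 hk

lemma S_int {S : ℝ → ℝ} (hS : Continuous S) {K ν : ℝ} (hν : 0 < ν)
    (hb : ∀ x, 0 < x → |S x| ≤ K * Real.exp (-ν * x)) :
    IntegrableOn S (Ioi 0) ∧ IntegrableOn (fun y => y * S y) (Ioi 0) := by
  constructor
  · refine Integrable.mono' ((exp_int2 hν).const_mul K) hS.aestronglyMeasurable ?_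
    filter_upwards [ae_restrict_mem measurableSet_Ioi] with x hx using hb x hx
  · refine Integrable.mono' ((exp_int2 (half_pos hν)).const_mul (K * (2 / ν)))
      (by fun_prop : Continuous _).aestronglyMeasurable ?_
    filter_upwards [ae_restrict_mem measurableSet_Ioi] with x hx
    have hx' : 0 < x := hx
    have hK : 0 ≤ K := by
      have := (abs_nonneg _).trans (hb x hx)
      exact nonneg_of_mul_nonneg_left this (Real.exp_pos _)
    rw [norm_mul, Real.norm_eq_abs, Real.norm_eq_abs, abs_of_pos hx']
    calc x * |S x| ≤ x * (K * Real.exp (-ν * x)) := mul_le_mul_of_nonneg_left (hb x hx) hx'.le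
      _ = K * (x * Real.exp (-ν * x)) := by ring
      _ ≤ K * (2 / ν * Real.exp (-(ν / 2) * x)) := mul_le_mul_of_nonneg_left (mul_exp_le hν) hK
      _ = _ := by ring

lemma asymp {p p' S : ℝ → ℝ} (h1 : ∀ x, HasDerivAt p (p' x) x) (h2 : ∀ x, HasDerivAt p' (S x) x)
    (hS : Continuous S) {K ν : ℝ} (hν : 0 < ν) (hb : ∀ x, |S x| ≤ K * Real.exp (-ν * x)) :
    (Tendsto p' atTop (𝓝 (p' 0 + ∫ y in Ioi (0:ℝ), S y))) ∧
    ∀ x, |p x - ((p' 0 + ∫ y in Ioi (0:ℝ), S y) * x + (p 0 - ∫ y in Ioi (0:ℝ), y * S y))|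
      ≤ K / ν / ν * Real.exp (-ν * x) := by
  obtain ⟨i1, i2⟩ := S_int hS hν (fun x _ => hb x)
  set A := p' 0 + ∫ y in Ioi (0:ℝ), S y with hA
  set B := p 0 - ∫ y in Ioi (0:ℝ), y * S y with hB
  have t1 : Tendsto p' atTop (𝓝 A) := by
    have := (intervalIntegral_tendsto_integral_Ioi 0 i1 tendsto_id).const_add (p' 0)
    refine this.congr fun x => ?_
    have := intervalIntegral.integral_eq_sub_of_hasDerivAt (a := 0) (b := x) (fun x _ => h2 x)
      (hS.intervalIntegrable 0 x)
    simp only [id]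
    rw [this]; ring
  have t2 : Tendsto (fun x => p x - x * p' x) atTop (𝓝 B) := by
    have := (intervalIntegral_tendsto_integral_Ioi 0 i2 tendsto_id).const_sub (p 0)
    refine this.congr fun x => ?_
    have := intervalIntegral.integral_eq_sub_of_hasDerivAt (a := 0) (b := x)
      (f := fun x => x * p' x - p x) (f' := fun y => y * S y)
      (fun x _ => (((hasDerivAt_id x).mul (h2 x)).sub (h1 x)).congr_deriv (by simp))
      ((by fun_prop : Continuous (fun y => y * S y)).intervalIntegrable 0 x)
    simp only [id]
    rw [this]; ring
  have d1 : ∀ x, |p' x - A| ≤ K / ν * Real.exp (-ν * x) :=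
    small_of_deriv (fun x => (h2 x).sub_const A) (by simpa using t1.sub_const A) hν hb
  have t3 : Tendsto (fun x => x * (p' x - A)) atTop (𝓝 0) := by
    have hlim : Tendsto (fun x => K / ν * (2 / ν * Real.exp (-(ν / 2) * x))) atTop (𝓝 0) := by
      have := ((Real.tendsto_exp_atBot.comp
        ((tendsto_id (α := ℝ)).const_mul_atTop_of_neg (by linarith : -(ν / 2) < 0))).const_mul
          (2 / ν)).const_mul (K / ν)
      simpa using this
    refine squeeze_zero_norm' ?_ hlim
    filter_upwards [eventually_ge_atTop 0] with x hx
    rw [norm_mul, Real.norm_eq_abs, Real.norm_eq_abs, abs_of_nonneg hx]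
    have hK : 0 ≤ K / ν := nonneg_of_mul_nonneg_left ((abs_nonneg _).trans (d1 x)) (Real.exp_pos _)
    calc x * |p' x - A| ≤ x * (K / ν * Real.exp (-ν * x)) := mul_le_mul_of_nonneg_left (d1 x) hx
      _ = K / ν * (x * Real.exp (-ν * x)) := by ring
      _ ≤ _ := mul_le_mul_of_nonneg_left (mul_exp_le hν) hK
  refine ⟨t1, small_of_deriv (F' := fun x => p' x - A) (fun x => ?_) ?_ hν d1⟩
  · have := (h1 x).sub (((hasDerivAt_id x).const_mul A).add_const B)
    exact this.congr_deriv (by simp)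
  · have := (t2.add t3).sub_const B
    simp only [add_zero, sub_self] at this
    refine this.congr fun x => ?_
    ring

section
variable {f : ℝ → ℝ} {α β C Λ η a1 a2 lam : ℝ}

lemma Fr.smooth (hn : NL f α β C) (hp : Par α β Λ η a1 a2 lam) {q : ℝ → ℝ}
    (hq : Fr f α η a1 a2 q) : ContDiff ℝ (⊤ : ℕ∞) q := by
  have hα := hn.hα
  have hη := hp.hη
  have hne : (1 / η) ≠ 0 := by positivity
  have e : q = fun x => 1 / α * Qop η a1 a2 (fun y => α * q y - f (q y)) x := by
    ext x; rw [← hq.fix]; field_simp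
  have b0 := hq.bcN hn
  have key : ∀ n : ℕ, ContDiff ℝ n q := by
    intro n
    induction n with
    | zero => exact contDiff_zero.2 hq.cont
    | succ n ih =>
      have hf : ContDiff ℝ n f := hn.smooth.of_le (by exact_mod_cast le_top)
      have h0 : ContDiff ℝ n (fun y => α * q y - f (q y)) := (contDiff_const.mul ih).sub (hf.comp ih)
      rw [e]
      refine contDiff_const.mul ?_
      refine Eop_contDiff_succ (Eop_bc (Eop_bc (Eop_bc b0 _) _) _) hne n ?_
      exact Eop_contDiff (Eop_bc (Eop_bc b0 _) _) _ n
        (Eop_contDiff (Eop_bc b0 _) _ n (Eop_contDiff b0 _ n h0))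
  exact contDiff_infty.2 key

lemma iter_step {u w : ℝ → ℝ} (hu : ContDiff ℝ (⊤ : ℕ∞) u) {a : ℝ}
    (hw : ∀ x, w x = u x + a * deriv u x) :
    ContDiff ℝ (⊤ : ℕ∞) w ∧ ∀ k x, iteratedDeriv k w x =
      iteratedDeriv k u x + a * iteratedDeriv (k + 1) u x := by
  have hd : ContDiff ℝ (⊤ : ℕ∞) (deriv u) := (contDiff_infty_iff_deriv.1 hu).2
  have e : w = u + fun x => a * deriv u x := funext hw
  constructor
  · rw [e]; exact hu.add (contDiff_const.mul hd)
  · intro k x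
    have hk : ((k : ℕ) : WithTop ℕ∞) ≤ ((⊤ : ℕ∞) : WithTop ℕ∞) := by exact_mod_cast le_top
    rw [e, iteratedDeriv_add (hu.of_le hk).contDiffAt ((contDiff_const.mul hd).of_le hk).contDiffAt,
      iteratedDeriv_const_mul_field, iteratedDeriv_succ']

lemma Fr.ode (hn : NL f α β C) (hp : Par α β Λ η a1 a2 lam) {q : ℝ → ℝ}
    (hq : Fr f α η a1 a2 q) {δ c : ℝ}
    (k1 : α * (2 * (1 / η) + a1 - a2) = c)
    (k2 : α * ((1 / η) ^ 2 + 2 * (1 / η) * (a1 - a2) - a1 * a2) = 1)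
    (k3 : (1 / η) ^ 2 * (a1 - a2) - 2 * (1 / η) * (a1 * a2) = 0)
    (k4 : α * (1 / η) ^ 2 * (a1 * a2) = δ ^ 2) (x : ℝ) :
    -δ ^ 2 * iteratedDeriv 4 q x + iteratedDeriv 2 q x + c * deriv q x + f (q x) = 0 := by
  have hα := hn.hα
  have hs := hq.smooth hn hp
  have b0 := hq.bcN hn
  have b1 := Eop_bc b0 (-a2)
  have b2 := Eop_bc b1 a1
  have b3 := Eop_bc b2 (1 / η)
  have e4 : Eop (1 / η) (Eop (1 / η) (Eop a1 (Eop (-a2) (fun y => α * q y - f (q y)))))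
    = fun x => α * q x := funext fun x => (hq.fix x).symm
  have s4 : ContDiff ℝ (⊤ : ℕ∞) (fun x => α * q x) := contDiff_const.mul hs
  have h3 : ∀ x, Eop (1 / η) (Eop a1 (Eop (-a2) (fun y => α * q y - f (q y)))) x
      = (fun x => α * q x) x + 1 / η * deriv (fun x => α * q x) x := by
    intro x
    have := Eop_inv b3 (1 / η) x
    rw [e4] at this
    exact this
  obtain ⟨s3, i3⟩ := iter_step s4 h3
  obtain ⟨s2, i2⟩ := iter_step s3 (Eop_inv b2 (1 / η))
  obtain ⟨s1, i1⟩ := iter_step s2 (Eop_inv b1 a1)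
  obtain ⟨s0, i0⟩ := iter_step s1 (Eop_inv b0 (-a2))
  have h := i0 0 x
  simp only [i1, i2, i3, zero_add, Nat.reduceAdd] at h
  simp only [iteratedDeriv_const_mul_field, iteratedDeriv_zero, iteratedDeriv_one] at h
  generalize 1 / η = e at *
  generalize iteratedDeriv 4 q x = q4 at *
  generalize iteratedDeriv 3 q x = q3 at *
  generalize iteratedDeriv 2 q x = q2 at *
  generalize deriv q x = q1 at *
  linear_combination (-1) * h - q1 * k1 - q2 * k2 - α * q3 * k3 + q4 * k4

/-- first derivative function data: `p = e^{ηx} q`. -/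
noncomputable def U3 (f : ℝ → ℝ) (α η a1 a2 : ℝ) (q : ℝ → ℝ) : ℝ → ℝ :=
  Eop (1 / η) (U2 f α a1 a2 q)

noncomputable def Sf (f : ℝ → ℝ) (α η a1 a2 : ℝ) (q : ℝ → ℝ) (x : ℝ) : ℝ :=
  η ^ 2 / α * (Real.exp (η * x) * U2 f α a1 a2 q x)

lemma expE {a : ℝ} {u h : ℝ → ℝ} (hh : BC h) (hu : ∀ x, u x = Eop (1 / a) h x) (ha : 0 < a) (x : ℝ) :
    HasDerivAt (fun x => Real.exp (a * x) * u x) (a * (Real.exp (a * x) * h x)) x := by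
  have h1 := Eop_hasDerivAt hh (a := 1 / a) (by positivity) x
  rw [← show u = Eop (1 / a) h from funext hu] at h1
  have h2 := (((hasDerivAt_id x).const_mul a).exp).mul h1
  refine h2.congr_deriv ?_
  simp only [id]; field_simp; ring

lemma Fr.d1 (hn : NL f α β C) (hp : Par α β Λ η a1 a2 lam) {q : ℝ → ℝ}
    (hq : Fr f α η a1 a2 q) (x : ℝ) :
    HasDerivAt (fun x => Real.exp (η * x) * q x)
      (η / α * (Real.exp (η * x) * U3 f α η a1 a2 q x)) x := by
  have hα := hn.hα
  have := expE (Eop_bc (hq.U2_bc hn) (1 / η)) (u := fun x => α * q x) hq.fix hp.hη x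
  have := this.const_mul (1 / α)
  refine (this.congr_deriv ?_).congr_of_eventuallyEq (Eventually.of_forall fun y => ?_)
  · unfold U3; ring
  · simp only []; field_simp

lemma Fr.d2 (hn : NL f α β C) (hp : Par α β Λ η a1 a2 lam) {q : ℝ → ℝ}
    (hq : Fr f α η a1 a2 q) (x : ℝ) :
    HasDerivAt (fun x => η / α * (Real.exp (η * x) * U3 f α η a1 a2 q x))
      (Sf f α η a1 a2 q x) x := by
  have := (expE (hq.U2_bc hn) (u := U3 f α η a1 a2 q) (fun x => rfl) hp.hη x).const_mul (η / α)
  refine this.congr_deriv ?_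
  unfold Sf; ring

lemma Fr.S_cont (hn : NL f α β C) {q : ℝ → ℝ}
    (hq : Fr f α η a1 a2 q) : Continuous (Sf f α η a1 a2 q) := by
  have := (hq.U2_bc hn).1
  unfold Sf; fun_prop

noncomputable def KS (α C X : ℝ) : ℝ := 25 / 16 * (2 * C * (64 * Real.exp (sg α * X)) ^ 2)

lemma Fr.S_le (hn : NL f α β C) (hp : Par α β Λ η a1 a2 lam) {q : ℝ → ℝ}
    (hq : Fr f α η a1 a2 q) {X : ℝ} (hX : q X ≤ α / (64 * C)) (x : ℝ) :
    |Sf f α η a1 a2 q x| ≤ KS α C X * Real.exp (-(2 * sg α - η) * x) := by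
  have hα := hn.hα
  have hη := hp.hη
  have h0 := hq.U2_nonneg hn x
  have h1 := hq.U2_le hn hp hX x
  have hs := Real.sq_sqrt hα.le
  have h2 : η ^ 2 / α ≤ 25 / 16 := by
    rw [div_le_iff₀ hα]
    have := pow_le_pow_left₀ hη.le hp.hη2 2
    nlinarith
  have e : Real.exp (-(2 * sg α - η) * x) = Real.exp (η * x) * Real.exp (-(2 * sg α) * x) := by
    rw [← Real.exp_add]; congr 1; ring
  unfold Sf
  have hE := Real.exp_pos (η * x)
  rw [abs_of_nonneg (by positivity), e]
  calc _ ≤ 25 / 16 * (Real.exp (η * x) * (2 * C * (64 * Real.exp (sg α * X)) ^ 2 *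
        Real.exp (-(2 * sg α) * x))) := by gcongr
    _ = _ := by unfold KS; ring

lemma Par.nu (hp : Par α β Λ η a1 a2 lam) : 1 / 4 * Real.sqrt α ≤ 2 * sg α - η := by
  have := hp.hη2; unfold sg; linarith

lemma exists_X (hn : NL f α β C) {q : ℝ → ℝ} (hq : Fr f α η a1 a2 q) :
    ∃ X, q X < α / (64 * C) := by
  have : 0 < α / (64 * C) := by have := hn.hα; have := hn.hC; positivity
  exact (hq.top.eventually (gt_mem_nhds this)).exists

noncomputable def Af (f : ℝ → ℝ) (α η a1 a2 : ℝ) (q : ℝ → ℝ) : ℝ :=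
  η / α * U3 f α η a1 a2 q 0 + ∫ y in Ioi (0:ℝ), Sf f α η a1 a2 q y

noncomputable def Bf (f : ℝ → ℝ) (α η a1 a2 : ℝ) (q : ℝ → ℝ) : ℝ :=
  q 0 - ∫ y in Ioi (0:ℝ), y * Sf f α η a1 a2 q y

lemma Fr.asymp (hn : NL f α β C) (hp : Par α β Λ η a1 a2 lam) {q : ℝ → ℝ}
    (hq : Fr f α η a1 a2 q) :
    0 < Af f α η a1 a2 q ∧ ∃ K, ∀ x, |q x - (Af f α η a1 a2 q * x + Bf f α η a1 a2 q) *
      Real.exp (-(η * x))| ≤ K * Real.exp (-(2 * sg α) * x) := by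
  have hα := hn.hα
  have hη := hp.hη
  obtain ⟨X, hX⟩ := exists_X hn hq
  have hν : 0 < 2 * sg α - η := lt_of_lt_of_le (by positivity) hp.nu
  obtain ⟨t, h⟩ := CF.asymp (hq.d1 hn hp) (hq.d2 hn hp) (hq.S_cont hn) hν (hq.S_le hn hp hX.le)
  have eA : η / α * (Real.exp (η * 0) * U3 f α η a1 a2 q 0) + ∫ y in Ioi (0:ℝ), Sf f α η a1 a2 q y
    = Af f α η a1 a2 q := by simp [Af]
  have eB : Real.exp (η * 0) * q 0 - ∫ y in Ioi (0:ℝ), y * Sf f α η a1 a2 q y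
    = Bf f α η a1 a2 q := by simp [Bf]
  rw [eA] at t
  simp only [eA, eB] at h
  refine ⟨?_, KS α C X / (2 * sg α - η) / (2 * sg α - η), fun x => ?_⟩
  · by_contra hneg
    push Not at hneg
    have mono : Monotone (fun x => η / α * (Real.exp (η * x) * U3 f α η a1 a2 q x)) := by
      refine monotone_of_hasDerivAt_nonneg (hq.d2 hn hp) fun x => ?_
      have := hq.U2_nonneg hn x
      unfold Sf
      have := Real.exp_pos (η * x)
      simp only [Pi.zero_apply]
      positivity
    have anti : Antitone (fun x => Real.exp (η * x) * q x) :=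
      antitone_of_hasDerivAt_nonpos (hq.d1 hn hp) fun x =>
        (mono.ge_of_tendsto t x).trans hneg
    have t0 : Tendsto (fun x => Real.exp (η * x) * q x) atBot (𝓝 0) := by
      have := (Real.tendsto_exp_atBot.comp (tendsto_id.const_mul_atBot hη)).mul hq.bot
      simpa using this
    have hle : ∀ x, q x ≤ 0 := by
      intro x
      have h1 := anti.ge_of_tendsto t0 x
      have := Real.exp_pos (η * x)
      by_contra hc
      push Not at hc
      have := mul_pos this hc
      linarith
    have := le_of_tendsto' hq.bot hle
    linarith
  · have h1 := mul_le_mul_of_nonneg_right (h x) (Real.exp_pos (-(η * x))).le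
    rw [mul_assoc, ← Real.exp_add] at h1
    have e1 : -(2 * sg α - η) * x + -(η * x) = -(2 * sg α) * x := by ring
    rw [e1] at h1
    refine le_trans (le_of_eq ?_) h1
    rw [← abs_of_pos (Real.exp_pos (-(η * x))), ← abs_mul, abs_of_pos (Real.exp_pos (-(η * x)))]
    congr 1
    have e2 : Real.exp (η * x) * Real.exp (-(η * x)) = 1 := by rw [← Real.exp_add]; simp
    linear_combination (-q x) * e2

end

section
variable {D : Type*} [TopologicalSpace D] [FirstCountableTopology D]
    {f : ℝ → ℝ} {α β C Λ : ℝ} {η a1 a2 lam : D → ℝ} {q : D → ℝ → ℝ}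

lemma AB_cont (hn : NL f α β C) (hp : ∀ d, Par α β Λ (η d) (a1 d) (a2 d) (lam d))
    (cη : Continuous η) (ca1 : Continuous a1) (ca2 : Continuous a2)
    (hq : ∀ d, Fr f α (η d) (a1 d) (a2 d) (q d)) (cq : Continuous (fun p : D × ℝ => q p.1 p.2)) :
    Continuous (fun d => Af f α (η d) (a1 d) (a2 d) (q d)) ∧
    Continuous (fun d => Bf f α (η d) (a1 d) (a2 d) (q d)) := by
  have hα := hn.hα
  have cf := hn.smooth.continuous
  have cN : Continuous (fun p : D × ℝ => α * q p.1 p.2 - f (q p.1 p.2)) := by fun_prop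
  have b0 : ∀ d x, |α * q d x - f (q d x)| ≤ α := fun d x => by
    have := hn.N_mem ((hq d).mem x)
    rw [abs_of_nonneg this.1]; exact this.2
  have b0' := fun d => (hq d).bcN hn
  have b1 : ∀ d x, |Eop (-a2 d) (fun y => α * q d y - f (q d y)) x| ≤ α := fun d =>
    Eop_abs (b0' d).1 (b0 d) _
  have b2 : ∀ d x, |U2 f α (a1 d) (a2 d) (q d) x| ≤ α := fun d =>
    Eop_abs (Eop_bc (b0' d) _).1 (b1 d) _
  have c2 : Continuous (fun p : D × ℝ => U2 f α (a1 p.1) (a2 p.1) (q p.1) p.2) :=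
    Eop_cont (Eop_cont (H := fun d y => α * q d y - f (q d y)) cN ca2.neg b0) ca1 b1
  have c3 : Continuous (fun p : D × ℝ => U3 f α (η p.1) (a1 p.1) (a2 p.1) (q p.1) p.2) :=
    Eop_cont c2 (continuous_const.div cη fun d => (hp d).hη.ne') b2
  have cS : Continuous (fun p : D × ℝ => Sf f α (η p.1) (a1 p.1) (a2 p.1) (q p.1) p.2) := by
    unfold Sf; fun_prop
  have sec : ∀ {g : D × ℝ → ℝ}, Continuous g → ∀ x, Continuous (fun d => g (d, x)) := fun hg x =>
    hg.comp (by fun_prop)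
  have hs : 0 < 1 / 4 * Real.sqrt α := by have := Real.sqrt_pos.2 hα; positivity
  set ν := 1 / 4 * Real.sqrt α with hν
  have bd : ∀ d0, ∃ K, ∀ᶠ d in 𝓝 d0, ∀ x, 0 < x →
      |Sf f α (η d) (a1 d) (a2 d) (q d) x| ≤ K * Real.exp (-ν * x) := by
    intro d0
    obtain ⟨X, hX⟩ := exists_X hn (hq d0)
    refine ⟨KS α C X, ?_⟩
    filter_upwards [(sec cq X).continuousAt.eventually (gt_mem_nhds hX)] with d hd x hx
    refine ((hq d).S_le hn (hp d) hd.le x).trans ?_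
    refine mul_le_mul_of_nonneg_left (Real.exp_le_exp.2 ?_) ?_
    · have := (hp d).nu; nlinarith
    · have := hn.hC; unfold KS; positivity
  constructor
  · refine Continuous.add ?_ ?_
    · have := sec c3 0
      simp only at this
      fun_prop
    · refine continuous_iff_continuousAt.2 fun d0 => ?_
      obtain ⟨K, hK⟩ := bd d0
      refine continuousAt_of_dominated (bound := fun y => K * Real.exp (-ν * y)) ?_ ?_
        ((exp_int2 hs).const_mul K) ?_
      · exact Eventually.of_forall fun d => ((hq d).S_cont hn).aestronglyMeasurable
      · filter_upwards [hK] with d hd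
        filter_upwards [ae_restrict_mem measurableSet_Ioi] with x hx using hd x hx
      · exact Eventually.of_forall fun y => (sec cS y).continuousAt
  · refine Continuous.sub (sec cq 0) ?_
    refine continuous_iff_continuousAt.2 fun d0 => ?_
    obtain ⟨K, hK⟩ := bd d0
    refine continuousAt_of_dominated
      (bound := fun y => K * (2 / ν * Real.exp (-(ν / 2) * y))) ?_ ?_
      (((exp_int2 (half_pos hs)).const_mul (2 / ν)).const_mul K) ?_
    · exact Eventually.of_forall fun d =>
        (continuous_id.mul ((hq d).S_cont hn)).aestronglyMeasurable
    · filter_upwards [hK] with d hd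
      filter_upwards [ae_restrict_mem measurableSet_Ioi] with x hx
      have hx' : 0 < x := hx
      have h1 := hd x hx
      have hK0 : 0 ≤ K := nonneg_of_mul_nonneg_left ((abs_nonneg _).trans h1) (Real.exp_pos _)
      rw [norm_mul, Real.norm_eq_abs, Real.norm_eq_abs, abs_of_pos hx']
      calc _ ≤ x * (K * Real.exp (-ν * x)) := mul_le_mul_of_nonneg_left h1 hx'.le
        _ = K * (x * Real.exp (-ν * x)) := by ring
        _ ≤ _ := mul_le_mul_of_nonneg_left (mul_exp_le hs) hK0
    · exact Eventually.of_forall fun y => (continuous_const.mul (sec cS y)).continuousAt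

/-- Polya-type lemma -/
lemma polya {q : D → ℝ → ℝ} (cq : Continuous (fun p : D × ℝ => q p.1 p.2))
    (hm : ∀ d x, q d x ∈ Icc (0:ℝ) 1) (ha : ∀ d, Antitone (q d)) (d0 : D)
    (hbot : Tendsto (q d0) atBot (𝓝 1)) (htop : Tendsto (q d0) atTop (𝓝 0)) {ε : ℝ} (hε : 0 < ε) :
    ∀ᶠ d in 𝓝 d0, ∀ x, |q d x - q d0 x| ≤ ε := by
  have hε2 : 0 < ε / 2 := half_pos hε
  obtain ⟨X, hX⟩ := (htop.eventually (gt_mem_nhds hε2)).exists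
  obtain ⟨Y, hY, hYX⟩ := ((hbot.eventually (lt_mem_nhds (by linarith : 1 - ε / 2 < 1))).and
    (eventually_le_atBot X)).exists
  have hunif : ∀ᶠ d in 𝓝 d0, ∀ x ∈ Icc Y X, |q d x - q d0 x| < ε / 2 := by
    have hK : IsCompact (Icc Y X) := isCompact_Icc
    have : ∀ x ∈ Icc Y X, ∀ᶠ z : D × ℝ in 𝓝 (d0, x), |q z.1 z.2 - q d0 z.2| < ε / 2 := by
      intro x _
      have c : Continuous (fun z : D × ℝ => |q z.1 z.2 - q d0 z.2|) := by
        have : Continuous (fun z : D × ℝ => q d0 z.2) :=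
          cq.comp (by fun_prop : Continuous (fun z : D × ℝ => (d0, z.2)))
        fun_prop
      exact c.continuousAt.eventually (gt_mem_nhds (by simpa using hε2))
    exact hK.eventually_forall_of_forall_eventually this
  filter_upwards [hunif] with d hd x
  have hmx := hm d x
  have hm0 := hm d0 x
  rcases le_total x Y with h | h
  · have h1 := ha d h
    have h2 := ha d0 h
    have h3 := abs_lt.1 (hd Y ⟨le_rfl, hYX⟩)
    rw [abs_le]; constructor <;> linarith [hmx.1, hmx.2, hm0.1, hm0.2]
  · rcases le_total X x with h' | h'
    · have h1 := ha d h'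
      have h2 := ha d0 h'
      have h3 := abs_lt.1 (hd X ⟨hYX, le_rfl⟩)
      rw [abs_le]; constructor <;> linarith [hmx.1, hmx.2, hm0.1, hm0.2]
    · linarith [hd x ⟨h, h'⟩]

end

section

lemma params {α : ℝ} (hα : 0 < α) : ∃ e a1 a2 : ℝ → ℝ, Continuous e ∧ Continuous a1 ∧ Continuous a2 ∧
    e 0 = Real.sqrt α ∧ a1 0 = 0 ∧ a2 0 = 0 ∧ ∀ δ : ℝ, 12 * δ ^ 2 * α ≤ 1 →
      etaStar α δ = e δ ∧ Real.sqrt α ≤ e δ ∧ 0 ≤ a1 δ ∧ 0 ≤ a2 δ ∧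
      α * (2 * (1 / e δ) + a1 δ - a2 δ) = 2 * e δ - 4 * δ ^ 2 * e δ ^ 3 ∧
      α * ((1 / e δ) ^ 2 + 2 * (1 / e δ) * (a1 δ - a2 δ) - a1 δ * a2 δ) = 1 ∧
      (1 / e δ) ^ 2 * (a1 δ - a2 δ) - 2 * (1 / e δ) * (a1 δ * a2 δ) = 0 ∧
      α * (1 / e δ) ^ 2 * (a1 δ * a2 δ) = δ ^ 2 := by
  let s : ℝ → ℝ := fun δ => Real.sqrt (1 - 12 * δ ^ 2 * α)
  let e : ℝ → ℝ := fun δ => Real.sqrt (2 * α / (1 + s δ))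
  let b : ℝ → ℝ := fun δ => (1 + s δ) / 2
  let R : ℝ → ℝ := fun δ => Real.sqrt (δ ^ 4 * e δ ^ 2 + δ ^ 2 * b δ)
  have s0 : ∀ δ, 0 ≤ s δ := fun δ => Real.sqrt_nonneg _
  have cs : Continuous s := by fun_prop
  have ce : Continuous e := by
    refine Continuous.sqrt (continuous_const.div (by fun_prop) fun δ => ?_)
    have := s0 δ; positivity
  have cb : Continuous b := by fun_prop
  have cR : Continuous R := by fun_prop
  have hb : ∀ δ, 0 < b δ := fun δ => by have := s0 δ; simp only [b]; positivity
  refine ⟨e, fun δ => (δ ^ 2 * e δ + R δ) / b δ, fun δ => (-(δ ^ 2 * e δ) + R δ) / b δ, ce,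
    Continuous.div (by fun_prop) cb fun δ => (hb δ).ne',
    Continuous.div (by fun_prop) cb fun δ => (hb δ).ne', ?_, ?_, ?_, ?_⟩
  · simp only [e, s]; norm_num
  · simp [R]
  · simp [R]
  intro δ hδ
  have hs0 := s0 δ
  have hs2 : s δ ^ 2 = 1 - 12 * δ ^ 2 * α := Real.sq_sqrt (by linarith)
  have hs1 : s δ ≤ 1 := by
    have : 0 ≤ δ ^ 2 * α := by positivity
    nlinarith
  have he2 : e δ ^ 2 = 2 * α / (1 + s δ) := Real.sq_sqrt (by positivity)
  have hepos : 0 < e δ := Real.sqrt_pos.2 (by positivity)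
  have hbp := hb δ
  have hR2 : R δ ^ 2 = δ ^ 4 * e δ ^ 2 + δ ^ 2 * b δ := Real.sq_sqrt (by positivity)
  have hR0 : 0 ≤ R δ := Real.sqrt_nonneg _
  have heb : e δ ^ 2 * b δ = α := by
    rw [he2]; simp only [b]; field_simp
  have hb3 : b δ = 1 - 3 * δ ^ 2 * e δ ^ 2 := by
    rw [he2]; simp only [b]; field_simp; nlinarith
  have heta : etaStar α δ = e δ := by
    unfold etaStar
    split_ifs with h
    · subst h; simp only [e, s]; norm_num
    · have hd : 0 < |δ| := abs_pos.2 h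
      have h6 : (0:ℝ) < Real.sqrt 6 := by positivity
      refine (pow_left_inj₀ (by positivity) hepos.le two_ne_zero).1 ?_
      change (1 / (|δ| * Real.sqrt 6) * Real.sqrt (1 - s δ)) ^ 2 = _
      rw [mul_pow, Real.sq_sqrt (by linarith), he2, div_pow, mul_pow, sq_abs, Real.sq_sqrt (by norm_num)]
      field_simp
      nlinarith
  refine ⟨heta, ?_, by positivity, ?_, ?_⟩
  · refine Real.sqrt_le_sqrt ?_
    rw [le_div_iff₀ (by linarith)]; nlinarith
  · refine div_nonneg ?_ hbp.le
    have : δ ^ 2 * e δ ≤ R δ := by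
      refine Real.le_sqrt_of_sq_le ?_
      have : 0 ≤ δ ^ 2 * b δ := by positivity
      nlinarith
    linarith
  simp only []
  generalize e δ = E at *
  generalize b δ = B at *
  generalize R δ = r at *
  have p : (δ ^ 2 * E + r) / B * ((-(δ ^ 2 * E) + r) / B) = δ ^ 2 / B := by
    field_simp; linear_combination hR2
  have m : (δ ^ 2 * E + r) / B - (-(δ ^ 2 * E) + r) / B = 2 * δ ^ 2 * E / B := by
    field_simp; ring
  rw [p, add_sub_assoc, m, ← heb]
  refine ⟨?_, ?_, ?_, ?_⟩
  · field_simp; rw [hb3]; ring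
  · field_simp; rw [hb3]; ring
  · field_simp; ring
  · field_simp

lemma P_mono {δ c Λ x y : ℝ} (hc : 0 < c) (h : 14 * δ ^ 2 * Λ ^ 2 ≤ 2) (hx : 0 ≤ x) (hxy : x < y)
    (hy : y ≤ Λ) : -δ ^ 2 * x ^ 4 + x ^ 2 + c * x < -δ ^ 2 * y ^ 4 + y ^ 2 + c * y := by
  have h1 : δ ^ 2 * (x ^ 2 + y ^ 2) ≤ 1 := by
    have hx2 : x ^ 2 ≤ Λ ^ 2 := by nlinarith
    have hy2 : y ^ 2 ≤ Λ ^ 2 := by nlinarith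
    have := mul_le_mul_of_nonneg_left (add_le_add hx2 hy2) (sq_nonneg δ)
    nlinarith
  have h2 : 0 ≤ (y + x) * (1 - δ ^ 2 * (x ^ 2 + y ^ 2)) := mul_nonneg (by linarith) (by linarith)
  have h3 : 0 < (y - x) * ((y + x) * (1 - δ ^ 2 * (x ^ 2 + y ^ 2)) + c) :=
    mul_pos (by linarith) (by linarith)
  nlinarith

lemma lam_exists {D : Type*} [TopologicalSpace D] {δ c : D → ℝ} {β : ℝ} (hβ : 0 < β)
    (cδ : Continuous δ) (cc : Continuous c) (hc : ∀ d, 0 < c d)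
    (h : ∀ d, 14 * δ d ^ 2 * (β + 1) ^ 2 ≤ 2) :
    ∃ lam : D → ℝ, Continuous lam ∧ ∀ d, 0 < lam d ∧ lam d ≤ β + 1 ∧
      -δ d ^ 2 * lam d ^ 4 + lam d ^ 2 + c d * lam d = β := by
  have ex : ∀ d, ∃ k ∈ Icc 0 (β + 1), -δ d ^ 2 * k ^ 4 + k ^ 2 + c d * k = β := by
    intro d
    have hcont : ContinuousOn (fun k => -δ d ^ 2 * k ^ 4 + k ^ 2 + c d * k) (Icc 0 (β + 1)) := by
      fun_prop
    have := intermediate_value_Icc (by linarith : (0:ℝ) ≤ β + 1) hcont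
    refine this ⟨by simpa using hβ.le, ?_⟩
    have h1 := mul_le_mul_of_nonneg_right (h d) (sq_nonneg (β + 1))
    have h2 := mul_pos (hc d) (by linarith : 0 < β + 1)
    nlinarith
  choose lam hm hl using ex
  have hpos : ∀ d, 0 < lam d := by
    intro d
    refine lt_of_le_of_ne (hm d).1 fun h0 => ?_
    have := hl d
    rw [← h0] at this
    simp at this
    linarith
  refine ⟨lam, ?_, fun d => ⟨hpos d, (hm d).2, hl d⟩⟩
  refine continuous_iff_continuousAt.2 fun d0 => tendsto_order.2 ⟨fun a ha => ?_, fun a ha => ?_⟩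
  · rcases le_or_gt a 0 with h0 | h0
    · exact Eventually.of_forall fun d => lt_of_le_of_lt h0 (hpos d)
    · have h1 := P_mono (hc d0) (h d0) h0.le ha (hm d0).2
      rw [hl] at h1
      have cP : Continuous (fun d => -δ d ^ 2 * a ^ 4 + a ^ 2 + c d * a) := by fun_prop
      filter_upwards [cP.continuousAt.eventually (gt_mem_nhds h1)] with d hd
      by_contra hcon
      push Not at hcon
      have haL : a ≤ β + 1 := ha.le.trans (hm d0).2
      rcases hcon.eq_or_lt with e | e
      · have := hl d; rw [e] at this; linarith
      · have := P_mono (hc d) (h d) (hm d).1 e haL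
        have := hl d; linarith
  · rcases lt_or_ge (β + 1) a with h0 | h0
    · exact Eventually.of_forall fun d => lt_of_le_of_lt (hm d).2 h0
    · have h1 := P_mono (hc d0) (h d0) (hm d0).1 ha h0
      rw [hl] at h1
      have cP : Continuous (fun d => -δ d ^ 2 * a ^ 4 + a ^ 2 + c d * a) := by fun_prop
      filter_upwards [cP.continuousAt.eventually (lt_mem_nhds h1)] with d hd
      by_contra hcon
      push Not at hcon
      rcases hcon.eq_or_lt with e | e
      · have := hl d; rw [← e] at this; linarith
      · have := P_mono (hc d) (h d) ((hm d0).1.trans ha.le) e (hm d).2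
        have := hl d; linarith

/-- Everything about parameters. -/
lemma all_params {α β : ℝ} (hα : 0 < α) (hβ : 0 < β) : ∃ δ₀ : ℝ, 0 < δ₀ ∧
    δ₀ < 1 / Real.sqrt (12 * α) ∧ ∃ a1 a2 lam : Ioo (-δ₀) δ₀ → ℝ,
      Continuous (fun d : Ioo (-δ₀) δ₀ => etaStar α d) ∧ Continuous a1 ∧ Continuous a2 ∧
      Continuous lam ∧ ∀ d : Ioo (-δ₀) δ₀,
      Par α β (β + 1) (etaStar α d) (a1 d) (a2 d) (lam d) ∧
      α * (2 * (1 / etaStar α d) + a1 d - a2 d) = cStar α d ∧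
      α * ((1 / etaStar α d) ^ 2 + 2 * (1 / etaStar α d) * (a1 d - a2 d) - a1 d * a2 d) = 1 ∧
      (1 / etaStar α d) ^ 2 * (a1 d - a2 d) - 2 * (1 / etaStar α d) * (a1 d * a2 d) = 0 ∧
      α * (1 / etaStar α d) ^ 2 * (a1 d * a2 d) = (d : ℝ) ^ 2 := by
  obtain ⟨e, a1, a2, ce, ca1, ca2, e0, a10, a20, H⟩ := params hα
  have hsq := Real.sqrt_pos.2 hα
  have cc : Continuous (fun δ : ℝ => 2 * e δ - 4 * δ ^ 2 * e δ ^ 3) := by fun_prop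
  have ev : ∀ᶠ δ in 𝓝 (0:ℝ), 12 * δ ^ 2 * α < 1 ∧ e δ < 5 / 4 * Real.sqrt α ∧
      a1 δ * Real.sqrt α < 1 / 3 ∧ a2 δ * (2 * (β + 1)) < 1 ∧ 0 < 2 * e δ - 4 * δ ^ 2 * e δ ^ 3 ∧
      14 * δ ^ 2 * (β + 1) ^ 2 < 2 := by
    refine Eventually.and ?_ (Eventually.and ?_ (Eventually.and ?_ (Eventually.and ?_
      (Eventually.and ?_ ?_))))
    · exact (by fun_prop : Continuous (fun δ : ℝ => 12 * δ ^ 2 * α)).continuousAt.eventually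
        (gt_mem_nhds (by simp))
    · exact ce.continuousAt.eventually (gt_mem_nhds (by rw [e0]; linarith))
    · exact (by fun_prop : Continuous (fun δ : ℝ => a1 δ * Real.sqrt α)).continuousAt.eventually
        (gt_mem_nhds (by simp [a10]))
    · exact (by fun_prop : Continuous (fun δ : ℝ => a2 δ * (2 * (β + 1)))).continuousAt.eventually
        (gt_mem_nhds (by simp [a20]))
    · exact cc.continuousAt.eventually (lt_mem_nhds (by simpa [e0] using hα))
    · exact (by fun_prop : Continuous (fun δ : ℝ => 14 * δ ^ 2 * (β + 1) ^ 2)).continuousAt.eventually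
        (gt_mem_nhds (by simp))
  obtain ⟨r, hr, hev⟩ := Metric.eventually_nhds_iff.1 ev
  have h12 : 0 < 1 / Real.sqrt (12 * α) := by positivity
  set δ₀ := min r (1 / Real.sqrt (12 * α)) / 2 with hδ₀
  have hm := lt_min hr h12
  have hlr := min_le_left r (1 / Real.sqrt (12 * α))
  have hl12 := min_le_right r (1 / Real.sqrt (12 * α))
  have hd : ∀ d : Ioo (-δ₀) δ₀, _ := fun d => hev (y := (d : ℝ)) (by
    rw [Real.dist_eq, sub_zero, abs_lt]; constructor <;> linarith [d.2.1, d.2.2])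
  obtain ⟨lam, cl, hl⟩ := lam_exists (D := Ioo (-δ₀) δ₀) (δ := fun d => (d : ℝ))
    (c := fun d => 2 * e d - 4 * (d : ℝ) ^ 2 * e d ^ 3) hβ continuous_subtype_val
    (cc.comp continuous_subtype_val) (fun d => (hd d).2.2.2.2.1) (fun d => (hd d).2.2.2.2.2.le)
  refine ⟨δ₀, by linarith, by linarith, fun d => a1 d, fun d => a2 d, lam, ?_,
    ca1.comp continuous_subtype_val, ca2.comp continuous_subtype_val, cl, fun d => ?_⟩
  · exact (ce.comp continuous_subtype_val).congr fun d => ((H d (hd d).1.le).1).symm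
  obtain ⟨g1, g2, g3, g4, g5, g6⟩ := hd d
  obtain ⟨q1, q2, q3, q4, k1, k2, k3, k4⟩ := H d g1.le
  obtain ⟨l1, l2, l3⟩ := hl d
  simp only [cStar, q1]
  refine ⟨?_, k1, k2, k3, k4⟩
  have key : ∀ k : ℝ, α * msym (e d) (a1 d) (a2 d) k = α +
      (-(d : ℝ) ^ 2 * k ^ 4 + k ^ 2 + (2 * e d - 4 * (d : ℝ) ^ 2 * e d ^ 3) * k) := by
    intro k
    unfold msym
    linear_combination k * k1 + k ^ 2 * k2 + α * k ^ 3 * k3 - k ^ 4 * k4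
  refine ⟨lt_of_lt_of_le hsq q2, q2, g2.le, q3, g3.le, q4, ?_, l1, l2, ?_, ?_⟩
  · refine lt_of_le_of_lt (mul_le_mul_of_nonneg_left ?_ q4) g4
    linarith
  · rw [key, l3]
  · rw [key]
    have h1 : (d : ℝ) ^ 2 * lam d ^ 2 ≤ (d : ℝ) ^ 2 * (β + 1) ^ 2 := by
      gcongr
    have h2 : 0 ≤ lam d ^ 2 * (2 - 14 * ((d : ℝ) ^ 2 * lam d ^ 2)) :=
      mul_nonneg (sq_nonneg _) (by linarith)
    nlinarith

end

theorem main (f : ℝ → ℝ) (hf : KPP f) :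
    ∃ δ₀ : ℝ, 0 < δ₀ ∧ δ₀ < 1 / Real.sqrt (12 * deriv f 0) ∧
      Nonempty (FrontFamily f δ₀) := by
  obtain ⟨C, hn⟩ := KPP.nl hf
  have hα := hn.hα
  obtain ⟨δ₀, h0, h1, a1, a2, lam, cη, ca1, ca2, clam, hp⟩ := all_params hn.hα hn.hβ
  refine ⟨δ₀, h0, h1, ?_⟩
  generalize hαdef : deriv f 0 = α at *
  generalize hβdef : -deriv f 1 = β at *
  obtain ⟨W, cW, W01, Wm, Wfix, Wb⟩ := raw_front hn (fun d => (hp d).1) cη ca1 ca2 clam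
  have cWd : ∀ d, Continuous (W d) := fun d =>
    cW.comp (by fun_prop : Continuous (fun x : ℝ => (d, x)))
  have hq : ∀ d : Ioo (-δ₀) δ₀, Fr f α (etaStar α d) (a1 d) (a2 d) (fun x => 1 - W d x) := fun d =>
    W_Fr hn (hp d).1 (cWd d) (W01 d) (Wm d) (Wfix d) (Wb d)
  obtain ⟨q, hqW⟩ : ∃ q : Ioo (-δ₀) δ₀ → ℝ → ℝ, q = fun d x => 1 - W d x := ⟨_, rfl⟩
  have cq : Continuous (fun p : Ioo (-δ₀) δ₀ × ℝ => q p.1 p.2) := by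
    rw [hqW]; exact continuous_const.sub cW
  replace hq : ∀ d : Ioo (-δ₀) δ₀, Fr f α (etaStar α d) (a1 d) (a2 d) (q d) := fun d => by rw [hqW]; exact hq d
  obtain ⟨cA, cB⟩ := AB_cont hn (fun d => (hp d).1) cη ca1 ca2 hq cq
  have has := fun d => (hq d).asymp hn (hp d).1
  obtain ⟨A, hA⟩ : ∃ A : Ioo (-δ₀) δ₀ → ℝ, A = fun d : Ioo (-δ₀) δ₀ =>
    Af f α (etaStar α d) (a1 d) (a2 d) (q d) := ⟨_, rfl⟩
  obtain ⟨B, hB⟩ : ∃ B : Ioo (-δ₀) δ₀ → ℝ, B = fun d : Ioo (-δ₀) δ₀ =>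
    Bf f α (etaStar α d) (a1 d) (a2 d) (q d) := ⟨_, rfl⟩
  rw [← hA] at cA
  rw [← hB] at cB
  have hApos : ∀ d, 0 < A d := fun d => by rw [hA]; exact (has d).1
  have hK : ∀ d : Ioo (-δ₀) δ₀, ∃ K, ∀ x, |q d x - (A d * x + B d) *
      Real.exp (-(etaStar α d * x))| ≤ K * Real.exp (-(2 * sg α) * x) := fun d => by
    rw [hA, hB]; exact (has d).2
  choose K hK using hK
  have hη : ∀ d : Ioo (-δ₀) δ₀, 0 < etaStar α d := fun d => (hp d).1.hη
  let s : Ioo (-δ₀) δ₀ → ℝ := fun d => Real.log (A d) / etaStar α d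
  have cs : Continuous s := (cA.log fun d => (hApos d).ne').div cη fun d => (hη d).ne'
  let m : Ioo (-δ₀) δ₀ → ℝ := fun d => s d + B d / A d
  have cm : Continuous m := cs.add (cB.div cA fun d => (hApos d).ne')
  let Q : Ioo (-δ₀) δ₀ → ℝ → ℝ := fun d x => q d (x + s d)
  have cQ : Continuous (fun p : Ioo (-δ₀) δ₀ × ℝ => Q p.1 p.2) :=
    cq.comp (by fun_prop : Continuous (fun p : Ioo (-δ₀) δ₀ × ℝ => (p.1, p.2 + s p.1)))
  have Qm : ∀ d x, Q d x ∈ Icc (0:ℝ) 1 := fun d x => (hq d).mem _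
  have Qa : ∀ d, Antitone (Q d) := fun d x y hxy => (hq d).anti (by linarith)
  have Qb : ∀ d, Tendsto (Q d) atBot (𝓝 1) := fun d =>
    (hq d).bot.comp (tendsto_atBot_add_const_right _ _ tendsto_id)
  have Qt : ∀ d, Tendsto (Q d) atTop (𝓝 0) := fun d =>
    (hq d).top.comp (tendsto_atTop_add_const_right _ _ tendsto_id)
  have Qs : ∀ d, ContDiff ℝ (⊤ : ℕ∞) (Q d) := fun d =>
    ((hq d).smooth hn (hp d).1).comp (contDiff_id.add contDiff_const)
  have Qode : ∀ (d : Ioo (-δ₀) δ₀) (x : ℝ), -(d : ℝ) ^ 2 * iteratedDeriv 4 (Q d) x +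
      iteratedDeriv 2 (Q d) x + cStar α d * deriv (Q d) x + f (Q d x) = 0 := by
    intro d x
    obtain ⟨p, k1, k2, k3, k4⟩ := hp d
    have := (hq d).ode hn p k1 k2 k3 k4 (x + s d)
    simp only [Q, iteratedDeriv_comp_add_const, deriv_comp_add_const]
    exact this
  have Qdec : ∀ (d : Ioo (-δ₀) δ₀) (x : ℝ), 0 ≤ x →
      |Q d x - (m d + x) * Real.exp (-(etaStar α d * x))| ≤
      (|K d| * Real.exp (-(2 * sg α) * s d) + 1) *
        Real.exp (-((etaStar α d + 1 / 4 * Real.sqrt α) * x)) := by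
    intro d x hx
    have h := hK d (x + s d)
    have hs : etaStar α d * s d = Real.log (A d) := mul_div_cancel₀ _ (hη d).ne'
    have e1 : Real.exp (-(etaStar α d * (x + s d))) = (A d)⁻¹ * Real.exp (-(etaStar α d * x)) := by
      rw [show -(etaStar α d * (x + s d)) = -Real.log (A d) + -(etaStar α d * x) by
        rw [← hs]; ring, Real.exp_add, Real.exp_neg, Real.exp_log (hApos d)]
    have hA0 := (hApos d).ne'
    have e2 : (A d * (x + s d) + B d) * Real.exp (-(etaStar α d * (x + s d)))
        = (m d + x) * Real.exp (-(etaStar α d * x)) := by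
      rw [e1]; simp only [m]; field_simp; ring
    rw [e2] at h
    refine h.trans ?_
    have e3 : Real.exp (-(2 * sg α) * (x + s d)) =
        Real.exp (-(2 * sg α) * s d) * Real.exp (-(2 * sg α) * x) := by
      rw [← Real.exp_add]; congr 1; ring
    have e4 : Real.exp (-(2 * sg α) * x) ≤
        Real.exp (-((etaStar α d + 1 / 4 * Real.sqrt α) * x)) := by
      refine Real.exp_le_exp.2 ?_
      have := (hp d).1.nu
      nlinarith
    rw [e3, ← mul_assoc]
    refine mul_le_mul ?_ e4 (Real.exp_pos _).le (by positivity)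
    have := mul_le_mul_of_nonneg_right (le_abs_self (K d)) (Real.exp_pos (-(2 * sg α) * s d)).le
    linarith
  classical
  let q' : ℝ → ℝ → ℝ := fun δ => if h : δ ∈ Ioo (-δ₀) δ₀ then Q ⟨δ, h⟩ else 0
  let m' : ℝ → ℝ := fun δ => if h : δ ∈ Ioo (-δ₀) δ₀ then m ⟨δ, h⟩ else 0
  let C' : ℝ → ℝ := fun δ => if h : δ ∈ Ioo (-δ₀) δ₀ then
    |K ⟨δ, h⟩| * Real.exp (-(2 * sg α) * s ⟨δ, h⟩) + 1 else 0
  have q'e : ∀ δ (h : δ ∈ Ioo (-δ₀) δ₀), q' δ = Q ⟨δ, h⟩ := fun δ h => dif_pos h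
  have m'e : ∀ δ (h : δ ∈ Ioo (-δ₀) δ₀), m' δ = m ⟨δ, h⟩ := fun δ h => dif_pos h
  have C'e : ∀ δ (h : δ ∈ Ioo (-δ₀) δ₀), C' δ =
    |K ⟨δ, h⟩| * Real.exp (-(2 * sg α) * s ⟨δ, h⟩) + 1 := fun δ h => dif_pos h
  refine ⟨{ η := 1 / 4 * Real.sqrt α, μ := m', q := q', C := C', η_pos := ?_, μ_cont := ?_,
            q_smooth := ?_, C_pos := ?_, ode := ?_, limit_left := ?_, decay := ?_, q_cont := ?_ }⟩
  · have := Real.sqrt_pos.2 hα; positivity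
  · refine continuousOn_iff_continuous_restrict.2 (cm.congr fun d => ?_)
    exact (m'e d d.2).symm
  · intro δ h; rw [q'e δ h]; exact Qs _
  · intro δ h; rw [C'e δ h]; positivity
  · intro δ h; rw [q'e δ h, hαdef]; exact Qode ⟨δ, h⟩
  · intro δ h; rw [q'e δ h]; exact Qb _
  · intro δ h; rw [q'e δ h, m'e δ h, C'e δ h, hαdef]; exact Qdec ⟨δ, h⟩
  · intro δ h ε hε
    obtain ⟨ρ, hρ, H⟩ := Metric.eventually_nhds_iff.1
      (polya cQ Qm Qa ⟨δ, h⟩ (Qb _) (Qt _) hε)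
    refine ⟨ρ, hρ, fun δ' h' hd x => ?_⟩
    rw [q'e δ h, q'e δ' h']
    exact H (y := ⟨δ', h'⟩) hd x

end CF

theorem stmt8 (f : ℝ → ℝ) (hf : KPP f) :
    ∃ δ₀ : ℝ, 0 < δ₀ ∧ δ₀ < 1 / Real.sqrt (12 * deriv f 0) ∧
      Nonempty (FrontFamily f δ₀) := by
  exact CF.main f hf
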